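/- Let n ≥ 1. There is no Schrödinger-type symbol p on ℝ^{2n} and energy E₀ > 0 such that the trapped set K(E₀) equals {ρ₁, ρ₂} ∪ 𝓗, where ρ₁ ≠ ρ₂ are hyperbolic fixed points of H_p at energy E₀ and 𝓗 is the union of the images of the heteroclinic trajectories from ρ₁ to ρ₂ (so that, in particular, there is no heteroclinic trajectory from ρ₂ to ρ₁). -/

import Mathlib

open Matrix Filter

/-- The Hamiltonian vector field `H_p = (∂_ξ p, −∂_x p)` of a symbol
`p : ℝⁿ × ℝⁿ → ℝ` (coordinates `(x, ξ)`). -/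
noncomputable def Hvf {n : ℕ} (p : (Fin n → ℝ) × (Fin n → ℝ) → ℝ)
    (ρ : (Fin n → ℝ) × (Fin n → ℝ)) : (Fin n → ℝ) × (Fin n → ℝ) :=
  (fun i => fderiv ℝ p ρ (0, Pi.single i 1),
   fun i => -fderiv ℝ p ρ (Pi.single i 1, 0))

/-- The trapped set `K(E₀)`: points of the energy surface `p = E₀` through which there is a
complete bounded Hamiltonian trajectory. -/
def trappedSet {n : ℕ} (p : (Fin n → ℝ) × (Fin n → ℝ) → ℝ) (E₀ : ℝ) :
    Set ((Fin n → ℝ) × (Fin n → ℝ)) :=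
  {ρ | p ρ = E₀ ∧ ∃ γ : ℝ → (Fin n → ℝ) × (Fin n → ℝ), γ 0 = ρ ∧
    (∀ t : ℝ, HasDerivAt γ (Hvf p (γ t)) t) ∧ Bornology.IsBounded (Set.range γ)}

/-- The union `𝓗` of the images of the heteroclinic Hamiltonian trajectories of `p`
from `ρ₁` to `ρ₂`. -/
def heteroclinicSet {n : ℕ} (p : (Fin n → ℝ) × (Fin n → ℝ) → ℝ)
    (ρ₁ ρ₂ : (Fin n → ℝ) × (Fin n → ℝ)) : Set ((Fin n → ℝ) × (Fin n → ℝ)) :=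
  {ρ | ∃ γ : ℝ → (Fin n → ℝ) × (Fin n → ℝ),
    (∀ t : ℝ, HasDerivAt γ (Hvf p (γ t)) t) ∧
    Tendsto γ atBot (nhds ρ₁) ∧ Tendsto γ atTop (nhds ρ₂) ∧ ρ ∈ Set.range γ}

/-- A Schrödinger-type symbol: `p(x,ξ) = a(x)ξ·ξ + b(x)·ξ + c(x)` with `a` smooth symmetric
uniformly elliptic, `b`, `c` smooth, and `a − Id`, `b`, `c` compactly supported. -/
def IsSchrodingerSymbol {n : ℕ} (p : (Fin n → ℝ) × (Fin n → ℝ) → ℝ) : Prop :=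
  ∃ (a : (Fin n → ℝ) → Matrix (Fin n) (Fin n) ℝ)
    (b : (Fin n → ℝ) → Fin n → ℝ) (c : (Fin n → ℝ) → ℝ) (δ : ℝ),
    (∀ i j, ContDiff ℝ (⊤ : ℕ∞) fun x => a x i j) ∧
    ContDiff ℝ (⊤ : ℕ∞) b ∧ ContDiff ℝ (⊤ : ℕ∞) c ∧
    (∀ x, (a x).IsSymm) ∧ 0 < δ ∧
    (∀ x v, δ * ∑ i, v i ^ 2 ≤ (a x).mulVec v ⬝ᵥ v) ∧
    HasCompactSupport (fun x => a x - 1) ∧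
    HasCompactSupport b ∧ HasCompactSupport c ∧
    ∀ x ξ, p (x, ξ) = (a x).mulVec ξ ⬝ᵥ ξ + b x ⬝ᵥ ξ + c x

/-- The standard symplectic form `ω((x,ξ),(y,η)) = ξ·y − x·η` on `ℝⁿ × ℝⁿ`. -/
def stdSymplectic {n : ℕ} (u v : (Fin n → ℝ) × (Fin n → ℝ)) : ℝ :=
  (∑ i, u.2 i * v.1 i) - ∑ i, u.1 i * v.2 i

/-- `ρ₀` is a hyperbolic fixed point of `H_p` at energy `E₀`: `H_p(ρ₀) = 0`, `p(ρ₀) = E₀`,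
and after a smooth symplectic change of variables fixing `ρ₀`, the symbol takes the normal
form `E₀ + Σ λₖ/2((ξₖ−ξ₀ₖ)² − (xₖ−x₀ₖ)²) + O(|ρ − ρ₀|³)` with all `λₖ > 0`. -/
def IsHyperbolicFixedPt {n : ℕ} (p : (Fin n → ℝ) × (Fin n → ℝ) → ℝ) (E₀ : ℝ)
    (ρ₀ : (Fin n → ℝ) × (Fin n → ℝ)) : Prop :=
  Hvf p ρ₀ = 0 ∧ p ρ₀ = E₀ ∧
  ∃ (U : Set ((Fin n → ℝ) × (Fin n → ℝ)))
    (κ : (Fin n → ℝ) × (Fin n → ℝ) → (Fin n → ℝ) × (Fin n → ℝ))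
    (lam : Fin n → ℝ) (C : ℝ),
    IsOpen U ∧ ρ₀ ∈ U ∧ ContDiffOn ℝ (⊤ : ℕ∞) κ U ∧ Set.InjOn κ U ∧
    IsOpen (κ '' U) ∧ κ ρ₀ = ρ₀ ∧
    (∀ ρ ∈ U, ∀ u v, stdSymplectic (fderiv ℝ κ ρ u) (fderiv ℝ κ ρ v) = stdSymplectic u v) ∧
    (∀ k, 0 < lam k) ∧
    ∀ ρ ∈ U, |p (κ ρ) - (E₀ + ∑ k, lam k / 2 *
      ((ρ.2 k - ρ₀.2 k) ^ 2 - (ρ.1 k - ρ₀.1 k) ^ 2))| ≤ C * ‖ρ - ρ₀‖ ^ 3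

namespace TopAux
open MeasureTheory Metric Set

/-- The integral of `det (1 + t N(x))` over a bounded set is a polynomial in `t`. -/
lemma det_poly {E : Type*} [NormedAddCommGroup E] [InnerProductSpace ℝ E]
    [FiniteDimensional ℝ E] [MeasurableSpace E] [BorelSpace E] (μ : Measure E) [μ.IsAddHaarMeasure]
    (N : E → E →L[ℝ] E) (hN : Continuous N) (ρ : ℝ) :
    ∃ P : Polynomial ℝ, ∀ t : ℝ,
      ∫ x in ball (0 : E) ρ, (ContinuousLinearMap.id ℝ E + t • N x).det ∂μ = P.eval t := by
  classical
  let b := Module.finBasis ℝ E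
  let m := Module.finrank ℝ E
  let c : E → Fin m → Fin m → ℝ := fun x i j => LinearMap.toMatrix b b (N x : E →ₗ[ℝ] E) i j
  have hc : ∀ i j, Continuous fun x => c x i j := by
    intro i j
    simp only [c, LinearMap.toMatrix_apply]
    have h1 : Continuous fun x => N x (b j) := hN.clm_apply continuous_const
    have h2 : Continuous fun v : E => b.repr v i :=
      (LinearMap.continuous_of_finiteDimensional ((Finsupp.lapply i).comp b.repr.toLinearMap))
    exact h2.comp h1
  have hdet : ∀ x t, (ContinuousLinearMap.id ℝ E + t • N x).det =
      ∑ σ : Equiv.Perm (Fin m), ∑ s ∈ (Finset.univ : Finset (Fin m)).powerset,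
        t ^ (s.card) * (((Equiv.Perm.sign σ : ℤ) : ℝ) * ((∏ i ∈ s, c x (σ i) i) *
          ∏ i ∈ Finset.univ \ s, (1 : Matrix (Fin m) (Fin m) ℝ) (σ i) i)) := by
    intro x t
    have : (ContinuousLinearMap.id ℝ E + t • N x).det =
        LinearMap.det (LinearMap.id + t • (N x : E →ₗ[ℝ] E)) := rfl
    rw [this, ← LinearMap.det_toMatrix b, Matrix.det_apply]
    refine Finset.sum_congr rfl fun σ _ => ?_
    have h3 : ∀ i, (LinearMap.toMatrix b b (LinearMap.id + t • (N x : E →ₗ[ℝ] E))) (σ i) i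
        = t * c x (σ i) i + (1 : Matrix (Fin m) (Fin m) ℝ) (σ i) i := by
      intro i
      rw [map_add, LinearMap.toMatrix_id, map_smul, add_comm]
      rfl
    simp only [h3]
    rw [Finset.prod_add, Finset.smul_sum]
    refine Finset.sum_congr rfl fun s _ => ?_
    rw [Finset.prod_mul_distrib, Finset.prod_const, Units.smul_def, zsmul_eq_mul]
    ring
  have hintg : ∀ (σ : Equiv.Perm (Fin m)) (s : Finset (Fin m)) (t : ℝ),
      IntegrableOn (fun x => t ^ (s.card) * (((Equiv.Perm.sign σ : ℤ) : ℝ) *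
        ((∏ i ∈ s, c x (σ i) i) *
          ∏ i ∈ Finset.univ \ s, (1 : Matrix (Fin m) (Fin m) ℝ) (σ i) i))) (ball (0:E) ρ) μ := by
    intro σ s t
    have hcont : Continuous (fun x => t ^ (s.card) * (((Equiv.Perm.sign σ : ℤ) : ℝ) *
        ((∏ i ∈ s, c x (σ i) i) *
          ∏ i ∈ Finset.univ \ s, (1 : Matrix (Fin m) (Fin m) ℝ) (σ i) i))) := by
      have : Continuous fun x => ∏ i ∈ s, c x (σ i) i :=
        continuous_finsetProd _ fun i _ => hc _ _
      fun_prop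
    exact (hcont.continuousOn.integrableOn_compact
      (isCompact_closedBall (0:E) ρ)).mono_set ball_subset_closedBall
  refine ⟨∑ σ : Equiv.Perm (Fin m), ∑ s ∈ (Finset.univ : Finset (Fin m)).powerset,
    Polynomial.C (∫ x in ball (0:E) ρ, (((Equiv.Perm.sign σ : ℤ) : ℝ) *
        ((∏ i ∈ s, c x (σ i) i) *
          ∏ i ∈ Finset.univ \ s, (1 : Matrix (Fin m) (Fin m) ℝ) (σ i) i)) ∂μ)
          * Polynomial.X ^ s.card, fun t => ?_⟩
  simp only [hdet]
  rw [integral_finsetSum _ (fun σ _ => integrable_finsetSum _ fun s _ => hintg σ s t),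
    Polynomial.eval_finsetSum]
  refine Finset.sum_congr rfl fun σ _ => ?_
  rw [integral_finsetSum _ (fun s _ => hintg σ s t), Polynomial.eval_finsetSum]
  refine Finset.sum_congr rfl fun s _ => ?_
  rw [integral_const_mul, Polynomial.eval_mul, Polynomial.eval_C, Polynomial.eval_pow,
    Polynomial.eval_X, mul_comm]

/-- Lipschitz maps on a closed ball vanishing on the sphere extend by zero. -/
lemma lip_ext {E : Type*} [NormedAddCommGroup E] [InnerProductSpace ℝ E]
    (g : E → E) (ρ : ℝ) (K : NNReal) (hg : LipschitzOnWith K g (closedBall 0 ρ))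
    (h0 : ∀ v, ρ ≤ ‖v‖ → g v = 0) : LipschitzWith K g := by
  have key : ∀ v w : E, ‖v‖ ≤ ρ → ρ < ‖w‖ → dist (g v) (g w) ≤ K * dist v w := by
    intro v w hv hw
    have hcont : ContinuousOn (fun t : ℝ => ‖v + t • (w - v)‖) (Icc 0 1) := by fun_prop
    have := intermediate_value_Icc (zero_le_one) hcont
    have hmem : ρ ∈ Icc (‖v + (0:ℝ) • (w - v)‖) (‖v + (1:ℝ) • (w - v)‖) := by
      constructor
      · simpa using hv
      · simpa using hw.le
    obtain ⟨t, ht, hz⟩ := this hmem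
    have hz' : ‖v + t • (w - v)‖ = ρ := hz
    rw [h0 w hw.le, ← h0 (v + t • (w - v)) hz'.ge]
    refine (hg.dist_le_mul v (by simpa using hv) _ (by simpa using hz'.le)).trans ?_
    gcongr
    rw [dist_eq_norm, dist_eq_norm]
    have : v - (v + t • (w - v)) = t • (v - w) := by
      simp [smul_sub]
    rw [this, norm_smul, Real.norm_of_nonneg ht.1]
    exact mul_le_of_le_one_left (norm_nonneg _) ht.2
  refine LipschitzWith.of_dist_le_mul fun v w => ?_
  rcases le_or_gt ‖v‖ ρ with hv | hv <;> rcases le_or_gt ‖w‖ ρ with hw | hw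
  · exact hg.dist_le_mul v (by simpa using hv) _ (by simpa using hw)
  · exact key v w hv hw
  · rw [dist_comm, dist_comm v]; exact key w v hw hv
  · rw [h0 v hv.le, h0 w hw.le]; simp; positivity

/-- No `C^1` retraction of the ball onto the sphere. -/
lemma no_smooth_retraction {E : Type*} [NormedAddCommGroup E] [InnerProductSpace ℝ E]
    [FiniteDimensional ℝ E] [Nontrivial E]
    (F : E → E) (hF : ContDiff ℝ 1 F) (ρ : ℝ) (hρ : 0 < ρ) (hn : ∀ v, ‖F v‖ = ρ)
    (hs : ∀ v, ‖v‖ = ρ → F v = v) : False := by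
  classical
  borelize E
  let μ : Measure E := Measure.addHaar
  let N : E → E →L[ℝ] E := fun x => fderiv ℝ F x - ContinuousLinearMap.id ℝ E
  have hN : Continuous N := (hF.continuous_fderiv (by simp)).sub continuous_const
  obtain ⟨P, hP⟩ := det_poly μ N hN ρ
  -- bound on N
  obtain ⟨K₀, hK₀⟩ := (isCompact_closedBall (0:E) ρ).exists_bound_of_continuousOn hN.continuousOn
  let K : NNReal := Real.toNNReal (max K₀ 1)
  have hK : (K : ℝ) = max K₀ 1 := Real.coe_toNNReal _ (by positivity)
  have hK1 : (1:ℝ) ≤ K := by rw [hK]; exact le_max_right _ _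
  have hNK : ∀ x ∈ closedBall (0:E) ρ, ‖N x‖ ≤ K := fun x hx => by
    rw [hK]; exact (hK₀ x hx).trans (le_max_left _ _)
  have hder : ∀ x, HasFDerivAt (fun v => F v - v) (N x) x := fun x =>
    ((hF.differentiable (by simp)) x).hasFDerivAt.sub (hasFDerivAt_id x)
  let g : E → E := fun v => if ‖v‖ ≤ ρ then F v - v else 0
  have hg0 : ∀ v, ρ ≤ ‖v‖ → g v = 0 := by
    intro v hv
    by_cases h : ‖v‖ ≤ ρ
    · have : F v = v := hs v (le_antisymm h hv)
      simp [g, this]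
    · simp [g, h]
  have hgL : LipschitzWith K g := by
    apply lip_ext g ρ K _ hg0
    have h1 : LipschitzOnWith K (fun v => F v - v) (closedBall 0 ρ) :=
      (convex_closedBall (0:E) ρ).lipschitzOnWith_of_nnnorm_hasFDerivWithin_le (𝕜 := ℝ)
        (fun x _ => (hder x).hasFDerivWithinAt) (fun x hx => by exact_mod_cast hNK x hx)
    intro v hv w hw
    have e1 : g v = F v - v := by simp only [g]; rw [if_pos (by simpa using hv)]
    have e2 : g w = F w - w := by simp only [g]; rw [if_pos (by simpa using hw)]
    rw [e1, e2]; exact h1 hv hw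
  -- small t
  have hsmall : ∀ t : ℝ, 0 < t → t < 1 / (2 * K) → P.eval t = μ.real (ball (0:E) ρ) := by
    intro t ht0 ht1
    have htK : t * K < 1 / 2 := by
      have : (0:ℝ) < 2 * K := by linarith
      rw [lt_div_iff₀ this] at ht1; linarith
    have ht2 : t < 1 := by nlinarith
    let f : E → E := fun v => v + t • g v
    have hlip : LipschitzWith (1/2) (fun v => t • g v) := by
      refine LipschitzWith.of_dist_le_mul fun v w => ?_
      rw [dist_smul₀, Real.norm_of_nonneg ht0.le]
      have := hgL.dist_le_mul v w
      have h2 := mul_le_mul_of_nonneg_left this ht0.le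
      have h3 : t * (K * dist v w) ≤ 1/2 * dist v w := by
        rw [← mul_assoc]; gcongr
      simpa using h2.trans h3
    have happ : ApproximatesLinearOn f ((ContinuousLinearEquiv.refl ℝ E : E ≃L[ℝ] E) : E →L[ℝ] E)
        univ (1/2) := by
      apply LipschitzOnWith.approximatesLinearOn
      have : (f - ⇑((ContinuousLinearEquiv.refl ℝ E : E ≃L[ℝ] E) : E →L[ℝ] E))
        = fun v => t • g v := by
        ext v; simp [f]
      rw [this]; exact hlip.lipschitzOnWith
    have hc : Subsingleton E ∨ (1/2 : NNReal) <
        ‖((ContinuousLinearEquiv.refl ℝ E).symm : E →L[ℝ] E)‖₊⁻¹ := by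
      right
      have : ‖((ContinuousLinearEquiv.refl ℝ E).symm : E →L[ℝ] E)‖₊ = 1 := by
        have h : ((ContinuousLinearEquiv.refl ℝ E).symm : E →L[ℝ] E)
          = ContinuousLinearMap.id ℝ E := rfl
        rw [h]; ext; simp
      rw [this]; 
      rw [inv_one]; exact NNReal.half_lt_self one_ne_zero
    let Φ := happ.toHomeomorph f hc
    have hbij : Function.Bijective f := Φ.bijective
    have himg : f '' ball (0:E) ρ = ball (0:E) ρ := by
      apply Subset.antisymm
      · rintro _ ⟨v, hv, rfl⟩
        have hv' : ‖v‖ < ρ := by simpa using hv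
        have e : f v = (1 - t) • v + t • F v := by
          simp only [f, g, if_pos hv'.le, smul_sub, sub_smul, one_smul]; abel
        rw [mem_ball_zero_iff, e]
        calc ‖(1 - t) • v + t • F v‖ ≤ ‖(1 - t) • v‖ + ‖t • F v‖ := norm_add_le _ _
          _ = (1 - t) * ‖v‖ + t * ρ := by
            rw [norm_smul, norm_smul, hn, Real.norm_of_nonneg ht0.le,
              Real.norm_of_nonneg (by linarith)]
          _ < ρ := by nlinarith
      · intro y hy
        obtain ⟨v, rfl⟩ := hbij.2 y
        refine ⟨v, ?_, rfl⟩
        by_contra h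
        have h' : ρ ≤ ‖v‖ := by simpa using h
        have : f v = v := by simp [f, hg0 v h']
        rw [this] at hy; exact h hy
    have hfd : ∀ x ∈ ball (0:E) ρ, HasFDerivWithinAt f (ContinuousLinearMap.id ℝ E + t • N x)
        (ball 0 ρ) x := by
      intro x hx
      have h1 : HasFDerivAt (fun v => v + t • (F v - v))
        (ContinuousLinearMap.id ℝ E + t • N x) x :=
        (hasFDerivAt_id x).add ((hder x).const_smul t)
      refine h1.hasFDerivWithinAt.congr (fun y hy => ?_) ?_
      · have : ‖y‖ ≤ ρ := by simpa using (mem_ball_zero_iff.1 hy).le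
        simp [f, g, this]
      · have : ‖x‖ ≤ ρ := by simpa using (mem_ball_zero_iff.1 hx).le
        simp [f, g, this]
    have hA := lintegral_abs_det_fderiv_eq_addHaar_image μ measurableSet_ball hfd
      (hbij.1.injOn)
    rw [himg] at hA
    have hpos : ∀ x ∈ ball (0:E) ρ, 0 < (ContinuousLinearMap.id ℝ E + t • N x).det := by
      intro x hx
      have hne : ∀ s ∈ Icc (0:ℝ) t, (ContinuousLinearMap.id ℝ E + s • N x).det ≠ 0 := by
        intro s hs hdet
        have hdet' : LinearMap.det ((ContinuousLinearMap.id ℝ E + s • N x : E →L[ℝ] E) :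
          E →ₗ[ℝ] E) = 0 := hdet
        have := LinearMap.bot_lt_ker_of_det_eq_zero hdet'
        obtain ⟨v, hv, hv0⟩ := (Submodule.ne_bot_iff _).1 this.ne'
        have hv1 : v + s • N x v = 0 := by simpa using hv
        have hnv : ‖v‖ = ‖s • N x v‖ :=
          (congrArg norm (eq_neg_of_add_eq_zero_left hv1)).trans (norm_neg _)
        rw [norm_smul, Real.norm_of_nonneg hs.1] at hnv
        have h4 : ‖N x v‖ ≤ K * ‖v‖ :=
          ((N x).le_opNorm v).trans (by gcongr; exact hNK x (ball_subset_closedBall hx))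
        have h5 : 0 < ‖v‖ := norm_pos_iff.2 hv0
        have h6 : s * ‖N x v‖ ≤ t * (K * ‖v‖) := mul_le_mul hs.2 h4 (norm_nonneg _) ht0.le
        nlinarith
      have hcont : ContinuousOn (fun s : ℝ => (ContinuousLinearMap.id ℝ E + s • N x).det)
          (Icc 0 t) := by
        have : Continuous fun s : ℝ => ContinuousLinearMap.id ℝ E + s • N x := by fun_prop
        exact (ContinuousLinearMap.continuous_det.comp this).continuousOn
      by_contra hle
      push Not at hle
      have := intermediate_value_Icc' ht0.le hcont
      have hm : (0:ℝ) ∈ Icc ((ContinuousLinearMap.id ℝ E + t • N x).det)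
          ((ContinuousLinearMap.id ℝ E + (0:ℝ) • N x).det) := by
        refine ⟨hle, ?_⟩
        have : (ContinuousLinearMap.id ℝ E + (0:ℝ) • N x).det = 1 := by
          rw [zero_smul, add_zero]
          exact LinearMap.det_id
        rw [this]; exact zero_le_one
      obtain ⟨s, hs, h⟩ := this hm
      exact hne s hs h
    rw [← hP t, Measure.real, ← hA, integral_eq_lintegral_of_nonneg_ae]
    · congr 1
      refine setLIntegral_congr_fun measurableSet_ball fun x hx => ?_
      rw [abs_of_pos (hpos x hx)]
    · exact (ae_restrict_iff' measurableSet_ball).2 (ae_of_all _ fun x hx => (hpos x hx).le)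
    · have : Continuous fun x => ContinuousLinearMap.id ℝ E + t • N x := by fun_prop
      exact (ContinuousLinearMap.continuous_det.comp this).aestronglyMeasurable
  have hPc : P = Polynomial.C (μ.real (ball (0:E) ρ)) := by
    apply Polynomial.eq_of_infinite_eval_eq
    refine (Ioo_infinite (a := (0:ℝ)) (b := 1 / (2 * K)) (by positivity)).mono ?_
    intro t ht
    simp [hsmall t ht.1 ht.2]
  have h1 := hP 1
  have hz : ∀ x, (ContinuousLinearMap.id ℝ E + (1:ℝ) • N x).det = 0 := by
    intro x
    have e : ContinuousLinearMap.id ℝ E + (1:ℝ) • N x = fderiv ℝ F x := by simp [N]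
    rw [e]
    by_contra hne
    have hne' : IsUnit (LinearMap.det (fderiv ℝ F x : E →ₗ[ℝ] E)) := isUnit_iff_ne_zero.2 hne
    have hsurj : Function.Surjective (fderiv ℝ F x) := by
      have := (LinearMap.isUnit_iff_isUnit_det _).2 hne'
      exact ((Module.End.isUnit_iff _).1 this).2
    obtain ⟨v, hv⟩ := hsurj (F x)
    have hd : HasFDerivAt F (fderiv ℝ F x) x := ((hF.differentiable (by simp)) x).hasFDerivAt
    have h2 := hd.norm_sq
    have h3 : (fun y => ‖F y‖ ^ 2) = fun _ => ρ ^ 2 := by ext y; rw [hn]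
    rw [h3] at h2
    have h4 := h2.unique (hasFDerivAt_const _ _)
    have h5 := DFunLike.congr_fun h4 v
    simp [hv, hn] at h5
    exact hρ.ne' h5
  simp only [hz, integral_zero, hPc, Polynomial.eval_C] at h1
  have : 0 < μ.real (ball (0:E) ρ) :=
    ENNReal.toReal_pos (measure_ball_pos μ 0 hρ).ne' measure_ball_lt_top.ne
  linarith

/-- No nonvanishing smooth map equal to the identity outside a ball. -/
lemma no_smooth_nonvanishing {E : Type*} [NormedAddCommGroup E] [InnerProductSpace ℝ E]
    [FiniteDimensional ℝ E] [Nontrivial E]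
    (H : E → E) (hH : ContDiff ℝ 1 H) (R : ℝ) (hR : 0 < R) (h0 : ∀ v, H v ≠ 0)
    (hid : ∀ v, R ≤ ‖v‖ → H v = v) : False := by
  refine no_smooth_retraction (fun v => (R / ‖H v‖) • H v) ?_ R hR ?_ ?_
  · exact (contDiff_const.div (hH.norm ℝ h0) fun v => norm_ne_zero_iff.2 (h0 v)).smul hH
  · intro v
    have := norm_pos_iff.2 (h0 v)
    rw [norm_smul, Real.norm_of_nonneg (by positivity)]
    field_simp
  · intro v hv
    rw [hid v hv.ge, hv, div_self hR.ne', one_smul]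

open scoped Manifold ContDiff in
/-- No nonvanishing continuous map equal to the identity outside a ball. -/
lemma no_nonvanishing {E : Type*} [NormedAddCommGroup E] [InnerProductSpace ℝ E]
    [FiniteDimensional ℝ E] [Nontrivial E]
    (H : E → E) (hH : Continuous H) (R : ℝ) (hR : 0 < R) (h0 : ∀ v, H v ≠ 0)
    (hid : ∀ v, R ≤ ‖v‖ → H v = v) : False := by
  let t : E → Set E := fun x => if ‖x‖ < R + 1 then ball (H x) ‖H x‖ else {x}
  have ht : ∀ x, Convex ℝ (t x) := by
    intro x
    simp only [t]
    split_ifs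
    · exact convex_ball _ _
    · exact convex_singleton _
  obtain ⟨g, hg⟩ := exists_contMDiffMap_forall_mem_convex_of_local (n := 1) 𝓘(ℝ, E) ht (by
    intro x
    by_cases hx : R < ‖x‖
    · refine ⟨{y | R < ‖y‖}, (isOpen_lt continuous_const continuous_norm).mem_nhds hx, id,
        contMDiff_id.contMDiffOn, ?_⟩
      intro y hy
      have hy' : R < ‖y‖ := hy
      simp only [t, id]
      split_ifs
      · rw [hid y hy'.le]
        exact mem_ball_self (hR.trans hy')
      · rfl
    · push Not at hx
      have hev : ∀ᶠ y in nhds x, ‖y‖ < R + 1 ∧ dist (H x) (H y) < ‖H y‖ := by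
        apply Filter.Eventually.and
        · exact continuous_norm.continuousAt.eventually_lt_const (by linarith)
        · have h1 : Continuous fun y => dist (H x) (H y) := by fun_prop
          have h2 : Continuous fun y => ‖H y‖ := by fun_prop
          exact h1.continuousAt.eventually_lt h2.continuousAt (by simpa using h0 x)
      refine ⟨_, hev, fun _ => H x, contMDiffOn_const, ?_⟩
      intro y hy
      simp only [t]
      rw [if_pos hy.1]
      exact hy.2)
  refine no_smooth_nonvanishing g g.contMDiff.contDiff (R + 1) (by linarith) ?_ ?_
  · intro v hv
    have h1 := hg v
    simp only [t] at h1
    split_ifs at h1 with h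
    · rw [hv] at h1; simp at h1
    · rw [hv] at h1
      have : (0:E) = v := h1
      rw [← this] at h; simp at h; linarith
  · intro v hv
    have h1 := hg v
    simp only [t] at h1
    rw [if_neg (not_lt.2 hv)] at h1
    exact h1

/-- The same in sup-norm coordinates. -/
lemma no_nonvanishing_pi {n : ℕ} (hn : 1 ≤ n) (H : (Fin n → ℝ) → (Fin n → ℝ))
    (hH : Continuous H) (R : ℝ) (h0 : ∀ v, H v ≠ 0)
    (hid : ∀ v, R ≤ ‖v‖ → H v = v) : False := by
  have : Nonempty (Fin n) := ⟨⟨0, hn⟩⟩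
  let e := EuclideanSpace.equiv (Fin n) ℝ
  have : Nontrivial (EuclideanSpace ℝ (Fin n)) := e.toEquiv.nontrivial
  obtain ⟨C, hC⟩ : ∃ C : ℝ, ∀ v : Fin n → ℝ, ‖e.symm v‖ ≤ C * ‖v‖ :=
    ⟨‖(e.symm : (Fin n → ℝ) →L[ℝ] EuclideanSpace ℝ (Fin n))‖, fun v =>
      (e.symm : (Fin n → ℝ) →L[ℝ] EuclideanSpace ℝ (Fin n)).le_opNorm v⟩
  have hR' : 0 < (max C 1) * (max R 1) := by positivity
  refine no_nonvanishing (fun v => e.symm (H (e v))) (by fun_prop) _ hR' ?_ ?_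
  · intro v hv
    exact h0 (e v) (by simpa using hv)
  · intro v hv
    have h1 : R ≤ ‖e v‖ := by
      have h2 := hC (e v)
      rw [e.symm_apply_apply] at h2
      have h3 : max C 1 * max R 1 ≤ max C 1 * ‖e v‖ :=
        hv.trans (h2.trans (by gcongr; exact le_max_left _ _))
      exact (le_max_left _ _).trans (le_of_mul_le_mul_left h3 (by positivity))
    simp only [hid _ h1, e.symm_apply_apply]

/-- The topological obstruction. -/
lemma topological_obstruction {n : ℕ} (hn : 1 ≤ n) (x₁ x₂ : Fin n → ℝ) (r T : ℝ) (hr : 0 < r)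
    (hT : 0 ≤ T)
    (hr2 : r < ‖x₁ - x₂‖) (G : (Fin n → ℝ) → ℝ → (Fin n → ℝ))
    (hG : ContinuousOn (Function.uncurry G) (sphere 0 r ×ˢ Icc 0 T))
    (hG0 : ∀ u, ‖u‖ = r → G u 0 = x₂ + u)
    (h1 : ∀ u, ‖u‖ = r → ∀ t ∈ Icc 0 T, G u t ≠ x₁)
    (h2 : ∀ u, ‖u‖ = r → ∀ t ∈ Icc 0 T, G u t ≠ x₂)
    (h3 : ∀ u, ‖u‖ = r → ∀ s ∈ Icc (0:ℝ) 1, G u T ≠ x₂ + s • (x₁ - x₂)) : False := by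
  classical
  let τ : ℝ → ℝ := fun s => max 0 (min 1 (min s (3 - s)))
  let σ : ℝ → ℝ := fun s => max 0 (min 1 (s - 1))
  have hτ : ∀ s, τ s ∈ Icc (0:ℝ) 1 := fun s =>
    ⟨le_max_left _ _, max_le zero_le_one (min_le_left _ _)⟩
  have hσ : ∀ s, σ s ∈ Icc (0:ℝ) 1 := fun s =>
    ⟨le_max_left _ _, max_le zero_le_one (min_le_left _ _)⟩
  have hτT : ∀ s, T * τ s ∈ Icc 0 T := fun s =>
    ⟨mul_nonneg hT (hτ s).1, mul_le_of_le_one_right hT (hτ s).2⟩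
  let S : (Fin n → ℝ) → ℝ := fun v => 4 - ‖v‖ / r
  let K : (Fin n → ℝ) → (Fin n → ℝ) := fun v => (‖v‖ / r) •
    (G ((r / ‖v‖) • v) (T * τ (S v)) - x₂ + σ (S v) • (x₂ - x₁))
  let H : (Fin n → ℝ) → (Fin n → ℝ) := fun v => if ‖v‖ ≤ r then x₂ + v - x₁ else K v
  have hu : ∀ v : Fin n → ℝ, r ≤ ‖v‖ → ‖(r / ‖v‖) • v‖ = r := by
    intro v hv
    have : 0 < ‖v‖ := hr.trans_le hv
    rw [norm_smul, Real.norm_of_nonneg (by positivity)]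
    field_simp
  have hKr : ∀ v, ‖v‖ = r → K v = x₂ + v - x₁ := by
    intro v hv
    have e1 : S v = 3 := by simp only [S, hv, div_self hr.ne']; norm_num
    have e2 : τ 3 = 0 := by simp only [τ]; norm_num
    have e3 : σ 3 = 1 := by simp only [σ]; norm_num
    simp only [K, e1, e2, e3, hv, div_self hr.ne', one_smul, mul_zero, hG0 v hv]
    abel
  have hKc : ContinuousOn K {v | r ≤ ‖v‖} := by
    have hn0 : ∀ v ∈ {v : Fin n → ℝ | r ≤ ‖v‖}, ‖v‖ ≠ 0 := fun v hv => (hr.trans_le hv).ne'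
    have hS : Continuous S := by fun_prop
    have hτc : Continuous τ := by fun_prop
    have hσc : Continuous σ := by fun_prop
    have hin : ContinuousOn (fun v : Fin n → ℝ => ((r / ‖v‖) • v, T * τ (S v)))
        {v | r ≤ ‖v‖} := by
      apply ContinuousOn.prodMk
      · exact (continuousOn_const.div continuous_norm.continuousOn hn0).smul continuousOn_id
      · exact (continuous_const.mul (hτc.comp hS)).continuousOn
    have hGc := hG.comp hin (fun v hv => ⟨by simpa using hu v hv, hτT _⟩)
    have : ContinuousOn (fun v => G ((r / ‖v‖) • v) (T * τ (S v))) {v | r ≤ ‖v‖} := hGc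
    have hσS : Continuous fun v => σ (S v) • (x₂ - x₁) := (hσc.comp hS).smul continuous_const
    exact (continuous_norm.div_const r).continuousOn.smul
      ((this.sub continuousOn_const).add hσS.continuousOn)
  have hHc : Continuous H := by
    rw [← continuousOn_univ]
    have huniv : (univ : Set (Fin n → ℝ)) = {v | ‖v‖ ≤ r} ∪ {v | r ≤ ‖v‖} := by
      ext v; simp [le_total]
    rw [huniv]
    apply ContinuousOn.union_of_isClosed
    · have : Continuous fun v : Fin n → ℝ => x₂ + v - x₁ := by fun_prop
      exact this.continuousOn.congr fun v hv => if_pos hv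
    · refine hKc.congr fun v hv => ?_
      by_cases h : ‖v‖ ≤ r
      · simp only [H, if_pos h]
        exact (hKr v (le_antisymm h hv)).symm
      · simp only [H, if_neg h]
    · exact isClosed_le continuous_norm continuous_const
    · exact isClosed_le continuous_const continuous_norm
  refine no_nonvanishing_pi hn H hHc (4 * r) ?_ ?_
  · intro v hv
    by_cases h : ‖v‖ ≤ r
    · simp only [H, if_pos h] at hv
      have : x₁ - x₂ = v := by
        rw [sub_eq_zero] at hv; rw [← hv]; abel
      rw [this] at hr2; linarith
    · simp only [H, if_neg h, K] at hv
      push Not at h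
      have hpos : ‖v‖ / r ≠ 0 := (div_pos (hr.trans h) hr).ne'
      have hv' := (smul_eq_zero.1 hv).resolve_left hpos
      have hun := hu v h.le
      rcases le_total (S v) 1 with hs1 | hs1
      · have : σ (S v) = 0 := by
          simp only [σ]; rw [max_eq_left]; exact (min_le_right _ _).trans (by linarith)
        rw [this, zero_smul, add_zero, sub_eq_zero] at hv'
        exact h2 _ hun _ (hτT _) hv'
      · rcases le_total (S v) 2 with hs2 | hs2
        · have : τ (S v) = 1 := by
            simp only [τ]
            rw [min_eq_left (le_min hs1 (by linarith)), max_eq_right zero_le_one]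
          rw [this, mul_one] at hv'
          refine h3 _ hun _ (hσ (S v)) ?_
          rw [← sub_eq_zero, ← hv', smul_sub, smul_sub]; abel
        · have : σ (S v) = 1 := by
            simp only [σ]; rw [min_eq_left (by linarith), max_eq_right zero_le_one]
          rw [this, one_smul] at hv'
          refine h1 _ hun _ (hτT (S v)) ?_
          rw [← sub_eq_zero, ← hv']; abel
  · intro v hv
    have h : ¬ ‖v‖ ≤ r := by push Not; linarith
    have hvp : 0 < ‖v‖ := by linarith
    have hS0 : S v ≤ 0 := by
      have : 4 ≤ ‖v‖ / r := by rw [le_div_iff₀ hr]; exact hv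
      simp only [S]; linarith
    have e2 : τ (S v) = 0 := by
      simp only [τ]; rw [max_eq_left]
      exact (min_le_right _ _).trans ((min_le_left _ _).trans hS0)
    have e3 : σ (S v) = 0 := by
      simp only [σ]; rw [max_eq_left]; exact (min_le_right _ _).trans (by linarith)
    simp only [H, if_neg h, K, e2, e3, mul_zero, zero_smul, add_zero]
    rw [hG0 _ (hu v (by linarith)), add_sub_cancel_left, smul_smul]
    have : ‖v‖ / r * (r / ‖v‖) = 1 := by field_simp
    rw [this, one_smul]

end TopAux

namespace FlowAux
open Set

lemma unique_right {X : Type*} [NormedAddCommGroup X] [NormedSpace ℝ X]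
    (v : X → X) (K : NNReal) (hK : LipschitzWith K v) (f g : ℝ → X) (a b : ℝ)
    (hf : ∀ t ∈ Icc a b, HasDerivAt f (v (f t)) t)
    (hg : ∀ t ∈ Icc a b, HasDerivAt g (v (g t)) t) (h : f a = g a) : EqOn f g (Icc a b) :=
  ODE_solution_unique_of_mem_Icc_right (v := fun _ => v) (s := fun _ => univ) (K := K)
    (fun _ _ => hK.lipschitzOnWith)
    (fun t ht => (hf t ht).continuousAt.continuousWithinAt)
    (fun t ht => (hf t (Ico_subset_Icc_self ht)).hasDerivWithinAt) (fun _ _ => trivial)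
    (fun t ht => (hg t ht).continuousAt.continuousWithinAt)
    (fun t ht => (hg t (Ico_subset_Icc_self ht)).hasDerivWithinAt) (fun _ _ => trivial) h

/-- Global flow of a bounded Lipschitz vector field. -/
lemma exists_flow {X : Type*} [NormedAddCommGroup X] [NormedSpace ℝ X] [CompleteSpace X]
    (v : X → X) (K : NNReal) (hK : LipschitzWith K v) (M : NNReal) (hM : ∀ x, ‖v x‖ ≤ M) :
    ∃ φ : X → ℝ → X, (∀ x, φ x 0 = x) ∧ (∀ x t, HasDerivAt (φ x) (v (φ x t)) t) ∧
      Continuous (Function.uncurry φ) ∧ (∀ x s t, φ (φ x s) t = φ x (s + t)) := by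
  have hu : ∀ f g : ℝ → X, (∀ t, HasDerivAt f (v (f t)) t) → (∀ t, HasDerivAt g (v (g t)) t) →
      f 0 = g 0 → f = g := fun f g hf hg h =>
    ODE_solution_unique_univ (v := fun _ => v) (s := fun _ => univ) (K := K) (t₀ := 0)
      (fun _ => hK.lipschitzOnWith) (fun t => ⟨hf t, trivial⟩) (fun t => ⟨hg t, trivial⟩) h
  -- local existence on any interval
  have hloc : ∀ (x : X) (N : ℕ), ∃ α : ℝ → X, α 0 = x ∧
      ∀ t ∈ Ioo (-((N:ℝ) + 1)) ((N:ℝ) + 1), HasDerivAt α (v (α t)) t := by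
    intro x N
    have h0 : (0:ℝ) ∈ Icc (-((N:ℝ) + 1)) ((N:ℝ) + 1) := ⟨by linarith [Nat.cast_nonneg (α := ℝ) N],
      by positivity⟩
    have hPL : IsPicardLindelof (fun _ => v) (⟨0, h0⟩ : Icc (-((N:ℝ) + 1)) ((N:ℝ) + 1)) x
        (M * (N + 1)) 0 M K := by
      apply IsPicardLindelof.of_time_independent
      · intro y _; exact hM y
      · exact hK.lipschitzOnWith
      · simp
    obtain ⟨α, hα0, hα⟩ := hPL.exists_eq_forall_mem_Icc_hasDerivWithinAt (x := x) (by simp)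
    exact ⟨α, hα0, fun t ht => (hα t (Ioo_subset_Icc_self ht)).hasDerivAt (Icc_mem_nhds ht.1 ht.2)⟩
  choose α hα0 hα using hloc
  have hagree : ∀ (x : X) (N N' : ℕ), N ≤ N' → EqOn (α x N) (α x N')
      (Ioo (-((N:ℝ) + 1)) ((N:ℝ) + 1)) := by
    intro x N N' hN
    have hN' : (N:ℝ) ≤ N' := by exact_mod_cast hN
    have hpos : (0:ℝ) ≤ N := Nat.cast_nonneg N
    exact ODE_solution_unique_of_mem_Ioo (v := fun _ => v) (s := fun _ => univ) (K := K) (t₀ := 0)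
      (fun _ _ => hK.lipschitzOnWith) ⟨by linarith, by linarith⟩
      (fun t ht => ⟨hα x N t ht, trivial⟩)
      (fun t ht => ⟨hα x N' t ⟨by linarith [ht.1], by linarith [ht.2]⟩, trivial⟩)
      (by rw [hα0, hα0])
  let φ : X → ℝ → X := fun x t => α x ⌈|t|⌉₊ t
  have hmem : ∀ t : ℝ, t ∈ Ioo (-((⌈|t|⌉₊:ℝ) + 1)) ((⌈|t|⌉₊:ℝ) + 1) := by
    intro t
    have h1 := Nat.le_ceil |t|
    have h2 := le_abs_self t
    have h3 := neg_abs_le t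
    exact ⟨by linarith, by linarith⟩
  have hφN : ∀ x (N : ℕ) t, t ∈ Ioo (-((N:ℝ) + 1)) ((N:ℝ) + 1) → φ x t = α x N t := by
    intro x N t ht
    rcases le_total N ⌈|t|⌉₊ with h | h
    · exact (hagree x N _ h ht).symm
    · exact hagree x _ N h (hmem t)
  have hφ0 : ∀ x, φ x 0 = x := fun x => hα0 x _
  have hφd : ∀ x t, HasDerivAt (φ x) (v (φ x t)) t := by
    intro x t
    have h1 := hα x ⌈|t|⌉₊ t (hmem t)
    refine h1.congr_of_eventuallyEq ?_
    filter_upwards [Ioo_mem_nhds (hmem t).1 (hmem t).2] with s hs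
    exact hφN x _ s hs
  have hgron : ∀ x y t, dist (φ x t) (φ y t) ≤ dist x y * Real.exp (K * |t|) := by
    have hpos : ∀ (w : X → X) (ψ : X → ℝ → X), LipschitzWith K w → (∀ x, ψ x 0 = x) →
        (∀ x t, HasDerivAt (ψ x) (w (ψ x t)) t) → ∀ x y t, 0 ≤ t →
        dist (ψ x t) (ψ y t) ≤ dist x y * Real.exp (K * t) := by
      intro w ψ hw hψ0 hψ x y t ht
      have := dist_le_of_trajectories_ODE (v := fun _ => w) (K := K) (f := ψ x) (g := ψ y)
        (a := 0) (b := t) (δ := dist x y) (fun _ => hw)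
        (fun s _ => (hψ x s).continuousAt.continuousWithinAt)
        (fun s _ => (hψ x s).hasDerivWithinAt)
        (fun s _ => (hψ y s).continuousAt.continuousWithinAt)
        (fun s _ => (hψ y s).hasDerivWithinAt) (by rw [hψ0, hψ0]) t ⟨ht, le_rfl⟩
      simpa using this
    intro x y t
    rcases le_total 0 t with h | h
    · rw [abs_of_nonneg h]; exact hpos v φ hK hφ0 hφd x y t h
    · rw [abs_of_nonpos h]
      have := hpos (fun x => - v x) (fun x t => φ x (-t)) hK.neg
        (fun x => by simp [hφ0]) (fun x t => by
          have h := (hφd x (-t)).scomp t (hasDerivAt_neg t)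
          rw [neg_one_smul] at h
          exact h) x y (-t) (by linarith)
      simpa using this
  refine ⟨φ, hφ0, hφd, ?_, ?_⟩
  · rw [continuous_iff_continuousAt]
    rintro ⟨x, t⟩
    rw [Metric.continuousAt_iff']
    intro ε hε
    have hc : ContinuousAt (fun q : X × ℝ => dist q.1 x * Real.exp (K * |q.2|)
        + dist (φ x q.2) (φ x t)) (x, t) := by
      have h0 : Continuous (φ x) :=
        continuous_iff_continuousAt.2 fun s => (hφd x s).continuousAt
      have : Continuous (fun q : X × ℝ => φ x q.2) := h0.comp continuous_snd
      fun_prop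
    have hz : (fun q : X × ℝ => dist q.1 x * Real.exp (K * |q.2|)
        + dist (φ x q.2) (φ x t)) (x, t) = 0 := by simp
    have := Filter.Tendsto.eventually_lt_const (u := ε) (by rw [hz]; exact hε) hc
    filter_upwards [this] with q hq
    exact (dist_triangle _ (φ x q.2) _).trans_lt
      ((add_le_add (hgron q.1 x q.2) le_rfl).trans_lt hq)
  · intro x s t
    have := hu (φ (φ x s)) (fun t => φ x (s + t)) (hφd _)
      (fun t => by simpa using (hφd x (s + t)).comp_const_add s t) (by simp [hφ0])
    exact congrFun this t

end FlowAux

namespace SymAux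
open Set

lemma vec_decomp {n : ℕ} (v : (Fin n → ℝ) × (Fin n → ℝ)) :
    v = ∑ i, v.1 i • ((Pi.single i 1, 0) : (Fin n → ℝ) × (Fin n → ℝ)) +
      ∑ i, v.2 i • ((0, Pi.single i 1) : (Fin n → ℝ) × (Fin n → ℝ)) := by
  ext j
  · simp [Prod.fst_sum, Finset.sum_apply, Pi.single_apply]
  · simp [Prod.snd_sum, Finset.sum_apply, Pi.single_apply]

lemma fderiv_eq {n : ℕ} (p : (Fin n → ℝ) × (Fin n → ℝ) → ℝ) (ρ v : (Fin n → ℝ) × (Fin n → ℝ)) :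
    fderiv ℝ p ρ v = - stdSymplectic (Hvf p ρ) v := by
  conv_lhs => rw [vec_decomp v]
  simp only [map_add, map_sum, map_smul, stdSymplectic, Hvf, smul_eq_mul]
  rw [neg_sub, add_comm, sub_eq_add_neg, ← Finset.sum_neg_distrib]
  congr 1 <;> refine Finset.sum_congr rfl fun i _ => by ring

lemma fderiv_Hvf {n : ℕ} (p : (Fin n → ℝ) × (Fin n → ℝ) → ℝ) (ρ : (Fin n → ℝ) × (Fin n → ℝ)) :
    fderiv ℝ p ρ (Hvf p ρ) = 0 := by
  rw [fderiv_eq, stdSymplectic, neg_eq_zero, sub_eq_zero]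
  exact Finset.sum_congr rfl fun i _ => mul_comm _ _

lemma Hvf_zero {n : ℕ} {p : (Fin n → ℝ) × (Fin n → ℝ) → ℝ} {ρ : (Fin n → ℝ) × (Fin n → ℝ)}
    (h : Hvf p ρ = 0) : fderiv ℝ p ρ = 0 := by
  ext v
  · simp [fderiv_eq, h, stdSymplectic]
  · simp [fderiv_eq, h, stdSymplectic]

lemma Hvf_contDiff {n : ℕ} {p : (Fin n → ℝ) × (Fin n → ℝ) → ℝ} (hp : ContDiff ℝ (⊤ : ℕ∞) p) :
    ContDiff ℝ 1 (Hvf p) := by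
  have h1 : ContDiff ℝ 1 (fderiv ℝ p) := (hp.of_le (m := 2) (WithTop.coe_le_coe.2 (le_top : (2 : ℕ∞) ≤ ⊤))).fderiv_right (m := 1) (by norm_num)
  unfold Hvf
  apply ContDiff.prodMk
  · exact contDiff_pi.2 fun i => h1.clm_apply contDiff_const
  · exact contDiff_pi.2 fun i => (h1.clm_apply contDiff_const).neg

lemma norm_sq_le_sum {n : ℕ} (x : Fin n → ℝ) : ‖x‖ ^ 2 ≤ ∑ i, x i ^ 2 := by
  have h0 : 0 ≤ ∑ i, x i ^ 2 := Finset.sum_nonneg fun i _ => sq_nonneg _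
  have : ‖x‖ ≤ Real.sqrt (∑ i, x i ^ 2) := by
    rw [pi_norm_le_iff_of_nonneg (Real.sqrt_nonneg _)]
    intro i
    apply Real.le_sqrt_of_sq_le
    rw [Real.norm_eq_abs, sq_abs]
    exact Finset.single_le_sum (f := fun i => x i ^ 2) (fun i _ => sq_nonneg _) (Finset.mem_univ i)
  calc ‖x‖ ^ 2 ≤ (Real.sqrt (∑ i, x i ^ 2)) ^ 2 := by gcongr
    _ = _ := Real.sq_sqrt h0

lemma abs_dot_le {n : ℕ} (x y : Fin n → ℝ) : |∑ i, x i * y i| ≤ n * (‖x‖ * ‖y‖) := by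
  calc |∑ i, x i * y i| ≤ ∑ i, |x i * y i| := Finset.abs_sum_le_sum_abs _ _
    _ ≤ ∑ _i : Fin n, ‖x‖ * ‖y‖ := by
      refine Finset.sum_le_sum fun i _ => ?_
      rw [abs_mul]
      exact mul_le_mul (norm_le_pi_norm x i) (norm_le_pi_norm y i) (abs_nonneg _) (norm_nonneg _)
    _ = _ := by simp

lemma sum_le_norm_sq {n : ℕ} (x : Fin n → ℝ) : ∑ i, x i ^ 2 ≤ n * ‖x‖ ^ 2 := by
  have := (le_abs_self _).trans (abs_dot_le x x)
  simpa [sq] using this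

/-- Basic facts on Schrödinger symbols. -/
structure Facts {n : ℕ} (p : (Fin n → ℝ) × (Fin n → ℝ) → ℝ) (E₀ : ℝ)
    (q : (Fin n → ℝ) → (Fin n → ℝ) → ℝ) (δ R C : ℝ) : Prop where
  smooth : ContDiff ℝ (⊤ : ℕ∞) p
  δpos : 0 < δ
  qcont : Continuous (Function.uncurry q)
  expand : ∀ x ξ η, p (x, ξ + η) = p (x, ξ) + fderiv ℝ p (x, ξ) (0, η) + q x η
  qlow : ∀ x η, δ * ‖η‖ ^ 2 ≤ q x η
  qhom : ∀ x (s : ℝ) η, q x (s • η) = s ^ 2 * q x η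
  free : ∀ x ξ, R < ∑ i, x i ^ 2 → p (x, ξ) = ∑ i, ξ i ^ 2
  bdd : ∀ x ξ, p (x, ξ) = E₀ → ‖ξ‖ ≤ C

lemma exists_facts {n : ℕ} {p : (Fin n → ℝ) × (Fin n → ℝ) → ℝ} (hp : IsSchrodingerSymbol p)
    (E₀ : ℝ) : ∃ q δ R C, Facts p E₀ q δ R C := by
  obtain ⟨a, b, c, δ, ha, hb, hc, -, hδ, hell, sa, sb, sc, hpf⟩ := hp
  have hsm : ContDiff ℝ (⊤ : ℕ∞) p := by
    have e : p = fun ρ => ∑ i, (∑ j, a ρ.1 i j * ρ.2 j) * ρ.2 i + ∑ i, b ρ.1 i * ρ.2 i + c ρ.1 := by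
      ext ⟨x, ξ⟩
      rw [hpf]; rfl
    rw [e]
    have h2 : ∀ i, ContDiff ℝ (⊤ : ℕ∞) fun ρ : (Fin n → ℝ) × (Fin n → ℝ) => ρ.2 i := fun i => by
      fun_prop
    have h3 : ∀ i j, ContDiff ℝ (⊤ : ℕ∞) fun ρ : (Fin n → ℝ) × (Fin n → ℝ) => a ρ.1 i j :=
      fun i j => (ha i j).comp contDiff_fst
    have h4 : ∀ i, ContDiff ℝ (⊤ : ℕ∞) fun ρ : (Fin n → ℝ) × (Fin n → ℝ) => b ρ.1 i :=
      fun i => (contDiff_pi.1 hb i).comp contDiff_fst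
    refine ((ContDiff.sum fun i _ => (ContDiff.sum fun j _ => (h3 i j).mul (h2 j)).mul (h2 i)).add
      (ContDiff.sum fun i _ => (h4 i).mul (h2 i))).add (hc.comp contDiff_fst)
  obtain ⟨Ba, hBa⟩ := sa.isBounded.exists_norm_le
  obtain ⟨Bb, hBb⟩ := sb.isBounded.exists_norm_le
  obtain ⟨Bc, hBc⟩ := sc.isBounded.exists_norm_le
  obtain ⟨Mb, hMb⟩ := sb.exists_bound_of_continuous hb.continuous
  obtain ⟨Mc, hMc⟩ := sc.exists_bound_of_continuous hc.continuous
  let r := max (max Ba Bb) (max Bc 0)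
  have hr0 : 0 ≤ r := (le_max_right _ _).trans (le_max_right _ _)
  have hMb0 : 0 ≤ Mb := (norm_nonneg _).trans (hMb 0)
  have hMc0 : 0 ≤ Mc := (norm_nonneg _).trans (hMc 0)
  have hlow : ∀ x η, δ * ‖η‖ ^ 2 ≤ (a x).mulVec η ⬝ᵥ η := fun x η =>
    (mul_le_mul_of_nonneg_left (norm_sq_le_sum η) hδ.le).trans (hell x η)
  refine ⟨fun x η => (a x).mulVec η ⬝ᵥ η, δ, n * r ^ 2, 1 + (|E₀| + Mc + n * Mb) / δ,
    hsm, hδ, ?_, ?_, hlow, ?_, ?_, ?_⟩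
  · have e : Function.uncurry (fun x η => (a x).mulVec η ⬝ᵥ η) = fun ρ =>
        ∑ i, (∑ j, a ρ.1 i j * ρ.2 j) * ρ.2 i := by
      ext ⟨x, ξ⟩; rfl
    rw [e]
    have h3 : ∀ i j, Continuous fun ρ : (Fin n → ℝ) × (Fin n → ℝ) => a ρ.1 i j :=
      fun i j => (ha i j).continuous.comp continuous_fst
    fun_prop
  · intro x ξ η
    let Lin := (a x).mulVec ξ ⬝ᵥ η + (a x).mulVec η ⬝ᵥ ξ + b x ⬝ᵥ η
    have hexp : ∀ t : ℝ, p (x, ξ + t • η) = p (x, ξ) + t * Lin + t ^ 2 *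
        ((a x).mulVec η ⬝ᵥ η) := by
      intro t
      simp only [hpf, Lin, Matrix.mulVec_add, Matrix.mulVec_smul, add_dotProduct, dotProduct_add,
        smul_dotProduct, dotProduct_smul, smul_eq_mul]
      ring
    have hd1 : HasDerivAt (fun t : ℝ => p (x, ξ + t • η)) Lin 0 := by
      have : (fun t : ℝ => p (x, ξ + t • η)) = fun t => p (x, ξ) + t * Lin + t ^ 2 *
        ((a x).mulVec η ⬝ᵥ η) := funext hexp
      rw [this]
      have := (((hasDerivAt_id (0:ℝ)).mul_const Lin).const_add (p (x, ξ))).add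
        (((hasDerivAt_id (0:ℝ)).pow 2).mul_const ((a x).mulVec η ⬝ᵥ η))
      refine HasDerivAt.congr_deriv (f := fun t : ℝ => p (x, ξ) + t * Lin + t ^ 2 *
        ((a x).mulVec η ⬝ᵥ η)) this ?_
      simp
    have hd2 : HasDerivAt (fun t : ℝ => p (x, ξ + t • η)) (fderiv ℝ p (x, ξ) (0, η)) 0 := by
      have h1 : HasFDerivAt p (fderiv ℝ p (x, ξ)) (x, ξ + (0:ℝ) • η) := by
        rw [zero_smul, add_zero]
        exact (hsm.differentiable (by simp) _).hasFDerivAt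
      have h2 : HasDerivAt (fun t : ℝ => (x, ξ + t • η)) ((0 : Fin n → ℝ), η) 0 := by
        refine (hasDerivAt_const _ _).prodMk ?_
        simpa using ((hasDerivAt_id (0:ℝ)).smul_const η).const_add ξ
      exact h1.comp_hasDerivAt (0:ℝ) h2
    have := hexp 1
    rw [hd2.unique hd1]
    simpa using this
  · intro x s η
    simp only [Matrix.mulVec_smul, smul_dotProduct, dotProduct_smul, smul_eq_mul]
    ring
  · intro x ξ hx
    have hxr : r < ‖x‖ := by
      by_contra h
      push Not at h
      have h1 := sum_le_norm_sq x
      have h2 : (n:ℝ) * ‖x‖ ^ 2 ≤ n * r ^ 2 := by gcongr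
      linarith
    have ea : a x - 1 = 0 := by
      by_contra h
      have := hBa x (subset_tsupport _ h)
      have h2 : Ba ≤ r := (le_max_left _ _).trans (le_max_left _ _)
      linarith
    have eb : b x = 0 := by
      by_contra h
      have := hBb x (subset_tsupport _ h)
      have h2 : Bb ≤ r := (le_max_right _ _).trans (le_max_left _ _)
      linarith
    have ec : c x = 0 := by
      by_contra h
      have := hBc x (subset_tsupport _ h)
      have h2 : Bc ≤ r := (le_max_left _ _).trans (le_max_right _ _)
      linarith
    rw [hpf, sub_eq_zero.1 ea, eb, ec, Matrix.one_mulVec, zero_dotProduct, add_zero, add_zero]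
    simp [dotProduct, sq]
  · intro x ξ hE
    rw [hpf] at hE
    have h1 := hlow x ξ
    have h2 : |b x ⬝ᵥ ξ| ≤ n * (‖b x‖ * ‖ξ‖) := abs_dot_le _ _
    have h3 : (n:ℝ) * (‖b x‖ * ‖ξ‖) ≤ n * (Mb * ‖ξ‖) := by gcongr; exact hMb x
    have h4 : |c x| ≤ Mc := hMc x
    have h5 := neg_abs_le (b x ⬝ᵥ ξ)
    have h6 := neg_abs_le (c x)
    have h7 := le_abs_self E₀
    by_contra hcon
    push Not at hcon
    have hq0 : 0 ≤ (|E₀| + Mc + n * Mb) / δ := by positivity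
    have hgt1 : 1 < ‖ξ‖ := by linarith
    have h8 : δ * ‖ξ‖ ^ 2 ≤ |E₀| + Mc + n * Mb * ‖ξ‖ := by linarith
    have h9 : δ * ‖ξ‖ > |E₀| + Mc + n * Mb := by
      have : (|E₀| + Mc + n * Mb) / δ < ‖ξ‖ := by linarith
      rw [div_lt_iff₀ hδ] at this; linarith
    have h10 := abs_nonneg E₀
    nlinarith

end SymAux

namespace SymAux
open Set

lemma Hvf_free {n : ℕ} {p : (Fin n → ℝ) × (Fin n → ℝ) → ℝ} {E₀ : ℝ}
    {q : (Fin n → ℝ) → (Fin n → ℝ) → ℝ} {δ R C : ℝ} (hF : Facts p E₀ q δ R C)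
    (ρ : (Fin n → ℝ) × (Fin n → ℝ)) (h : R < ∑ i, ρ.1 i ^ 2) :
    Hvf p ρ = ((2 : ℝ) • ρ.2, 0) := by
  have hev : p =ᶠ[nhds ρ] fun σ => ∑ i, σ.2 i ^ 2 := by
    have ho : IsOpen {σ : (Fin n → ℝ) × (Fin n → ℝ) | R < ∑ i, σ.1 i ^ 2} :=
      isOpen_lt continuous_const (by fun_prop)
    filter_upwards [ho.mem_nhds h] with σ hσ
    exact hF.free σ.1 σ.2 hσ
  have hd : HasFDerivAt (fun σ : (Fin n → ℝ) × (Fin n → ℝ) => ∑ i, σ.2 i ^ 2)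
      (∑ i, (2 * ρ.2 i) • ((ContinuousLinearMap.proj (R := ℝ) (φ := fun _ : Fin n => ℝ) i).comp
        (ContinuousLinearMap.snd ℝ (Fin n → ℝ) (Fin n → ℝ)))) ρ := by
    refine HasFDerivAt.fun_sum fun i _ => ?_
    have h1 := ((ContinuousLinearMap.proj (R := ℝ) (φ := fun _ : Fin n => ℝ) i).comp
        (ContinuousLinearMap.snd ℝ (Fin n → ℝ) (Fin n → ℝ))).hasFDerivAt (x := ρ)
    have h2 := h1.pow 2
    simpa using h2
  have hfd := (hd.congr_of_eventuallyEq hev).fderiv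
  unfold Hvf
  rw [hfd]
  ext i
  · simp [Pi.single_apply]
  · simp

/-- The Hamiltonian flow on the energy surface. -/
structure Flow {n : ℕ} (p : (Fin n → ℝ) × (Fin n → ℝ) → ℝ) (E₀ R : ℝ)
    (φ : (Fin n → ℝ) × (Fin n → ℝ) → ℝ → (Fin n → ℝ) × (Fin n → ℝ)) : Prop where
  cont : Continuous (Function.uncurry φ)
  zero : ∀ ρ, φ ρ 0 = ρ
  add : ∀ ρ s t, φ (φ ρ s) t = φ ρ (s + t)
  energy : ∀ ρ t, p ρ = E₀ → p (φ ρ t) = E₀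
  deriv : ∀ ρ t, p ρ = E₀ → HasDerivAt (φ ρ) (Hvf p (φ ρ t)) t
  uniq : ∀ γ : ℝ → (Fin n → ℝ) × (Fin n → ℝ), (∀ t, HasDerivAt γ (Hvf p (γ t)) t) →
    p (γ 0) = E₀ → ∀ t, γ t = φ (γ 0) t
  free : ∀ ρ : (Fin n → ℝ) × (Fin n → ℝ), p ρ = E₀ → R < ∑ i, ρ.1 i ^ 2 →
    0 < ∑ i, ρ.1 i * ρ.2 i → ∀ t : ℝ, 0 ≤ t → φ ρ t = (ρ.1 + (2 * t) • ρ.2, ρ.2)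

lemma exists_Flow {n : ℕ} {p : (Fin n → ℝ) × (Fin n → ℝ) → ℝ} {E₀ : ℝ}
    {q : (Fin n → ℝ) → (Fin n → ℝ) → ℝ} {δ R C : ℝ} (hF : Facts p E₀ q δ R C) :
    ∃ φ, Flow p E₀ R φ := by
  let χ : ContDiffBump (0 : Fin n → ℝ) := ⟨max C 0 + 1, max C 0 + 2, by positivity, by linarith⟩
  have hχ1 : ∀ ξ : Fin n → ℝ, ‖ξ‖ ≤ C → χ ξ = 1 := fun ξ h => by
    apply χ.one_of_mem_closedBall
    rw [mem_closedBall_zero_iff]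
    exact h.trans ((le_max_left C 0).trans (by simp [χ]))
  have hχ0 : ∀ ξ : Fin n → ℝ, max C 0 + 2 ≤ ‖ξ‖ → χ ξ = 0 := fun ξ h => by
    apply χ.zero_of_le_dist
    simpa using h
  have hχs : ContDiff ℝ 1 (χ : (Fin n → ℝ) → ℝ) := χ.contDiff
  let w : (Fin n → ℝ) × (Fin n → ℝ) → (Fin n → ℝ) × (Fin n → ℝ) :=
    fun ρ => χ ρ.2 • (Hvf p ρ - ((2 : ℝ) • ρ.2, 0))
  let g : (Fin n → ℝ) → (Fin n → ℝ) × (Fin n → ℝ) := fun η => χ η • ((2 : ℝ) • η, 0)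
  let v : (Fin n → ℝ) × (Fin n → ℝ) → (Fin n → ℝ) × (Fin n → ℝ) := fun ρ => χ ρ.2 • Hvf p ρ
  have hv : v = fun ρ => w ρ + g ρ.2 := by
    funext ρ
    simp only [v, w, g, ← smul_add, sub_add_cancel]
  have hwc : ContDiff ℝ 1 w := by
    refine (hχs.comp contDiff_snd).smul ((Hvf_contDiff hF.smooth).sub ?_)
    exact (contDiff_snd.const_smul (2:ℝ)).prodMk contDiff_const
  have hgc : ContDiff ℝ 1 g :=
    hχs.smul ((contDiff_id.const_smul (2:ℝ)).prodMk contDiff_const)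
  have hws : HasCompactSupport w := by
    refine HasCompactSupport.intro (isCompact_closedBall 0 (|R| + 1 + (max C 0 + 2))) ?_
    intro ρ hρ
    rw [mem_closedBall_zero_iff, not_le, Prod.norm_def, lt_max_iff] at hρ
    have h0 : 0 ≤ max C 0 := le_max_right _ _
    have hR := abs_nonneg R
    rcases hρ with h | h
    · have h1 : R < ∑ i, ρ.1 i ^ 2 := by
        have := norm_sq_le_sum ρ.1
        have := le_abs_self R
        nlinarith
      simp only [w, Hvf_free hF ρ h1, sub_self, smul_zero]
    · simp only [w]
      rw [hχ0 ρ.2 (by linarith), zero_smul]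
  have hgs : HasCompactSupport g := by
    refine HasCompactSupport.intro (isCompact_closedBall 0 (max C 0 + 2)) ?_
    intro η h
    rw [mem_closedBall_zero_iff, not_le] at h
    simp only [g]
    rw [hχ0 η h.le, zero_smul]
  obtain ⟨Kw, hKw⟩ := hwc.lipschitzWith_of_hasCompactSupport hws (by simp)
  obtain ⟨Kg, hKg⟩ := hgc.lipschitzWith_of_hasCompactSupport hgs (by simp)
  obtain ⟨Mw, hMw⟩ := hws.exists_bound_of_continuous hwc.continuous
  obtain ⟨Mg, hMg⟩ := hgs.exists_bound_of_continuous hgc.continuous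
  have hlip : LipschitzWith (Kw + Kg * 1) v := by
    rw [hv]; exact hKw.add (hKg.comp LipschitzWith.prod_snd)
  have hMg0 : 0 ≤ Mg := (norm_nonneg _).trans (hMg 0)
  have hMw0 : 0 ≤ Mw := (norm_nonneg _).trans (hMw 0)
  have hbd : ∀ ρ, ‖v ρ‖ ≤ (⟨Mw + Mg, by positivity⟩ : NNReal) := by
    intro ρ
    rw [hv]
    exact (norm_add_le _ _).trans (add_le_add (hMw ρ) (hMg ρ.2))
  obtain ⟨φ, h0, hd, hc, hadd⟩ := FlowAux.exists_flow v _ hlip _ hbd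
  have hpd : Differentiable ℝ p := hF.smooth.differentiable (by simp)
  have hen : ∀ ρ t, p (φ ρ t) = p ρ := by
    intro ρ t
    have hder : ∀ t, HasDerivAt (fun t => p (φ ρ t)) 0 t := by
      intro t
      have := (hpd (φ ρ t)).hasFDerivAt.comp_hasDerivAt t (hd ρ t)
      refine this.congr_deriv ?_
      simp only [v, map_smul, fderiv_Hvf, smul_zero]
    have := is_const_of_deriv_eq_zero (fun t => (hder t).differentiableAt)
      (fun t => (hder t).deriv) t 0
    simpa [h0] using this
  have hvH : ∀ ρ, p ρ = E₀ → v ρ = Hvf p ρ := by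
    intro ρ hρ
    simp only [v]
    rw [hχ1 ρ.2 (hF.bdd ρ.1 ρ.2 hρ), one_smul]
  have hunr : ∀ (f : ℝ → (Fin n → ℝ) × (Fin n → ℝ)) (b : ℝ), 0 ≤ b →
      (∀ t ∈ Icc 0 b, HasDerivAt f (v (f t)) t) → f b = φ (f 0) b := by
    intro f b hb hf
    exact FlowAux.unique_right v _ hlip f (φ (f 0)) 0 b hf (fun t _ => hd _ t) (h0 _).symm
      ⟨hb, le_rfl⟩
  refine ⟨φ, hc, h0, hadd, fun ρ t h => (hen ρ t).trans h, ?_, ?_, ?_⟩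
  · intro ρ t h
    rw [← hvH _ ((hen ρ t).trans h)]
    exact hd ρ t
  · intro γ hγ hE t
    have hEt : ∀ t, p (γ t) = E₀ := by
      intro t
      have hder : ∀ t, HasDerivAt (fun t => p (γ t)) 0 t := by
        intro t
        have := (hpd (γ t)).hasFDerivAt.comp_hasDerivAt t (hγ t)
        refine this.congr_deriv ?_
        simp only [fderiv_Hvf]
      have := is_const_of_deriv_eq_zero (fun t => (hder t).differentiableAt)
        (fun t => (hder t).deriv) t 0
      exact this.trans hE
    have hγv : ∀ t, HasDerivAt γ (v (γ t)) t := fun t => by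
      rw [hvH _ (hEt t)]; exact hγ t
    rcases le_total 0 t with ht | ht
    · exact hunr γ t ht fun s _ => hγv s
    · have h1 := hunr (fun s => γ (t + s)) (-t) (by linarith) (fun s _ => by
        simpa using (hγv (t + s)).comp_const_add t s)
      simp only [add_zero, add_neg_cancel] at h1
      rw [h1, hadd]; simp [h0]
  · intro ρ hE hR hpos t ht
    have hsq : ∀ s : ℝ, 0 ≤ s → R < ∑ i, (ρ.1 + (2 * s) • ρ.2) i ^ 2 := by
      intro s hs
      have e : ∑ i, (ρ.1 + (2 * s) • ρ.2) i ^ 2 = ∑ i, ρ.1 i ^ 2 + 4 * s * ∑ i, ρ.1 i * ρ.2 i +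
          (2 * s) ^ 2 * ∑ i, ρ.2 i ^ 2 := by
        simp only [Finset.mul_sum, ← Finset.sum_add_distrib]
        refine Finset.sum_congr rfl fun i _ => ?_
        simp; ring
      have h2 : 0 ≤ ∑ i, ρ.2 i ^ 2 := Finset.sum_nonneg fun i _ => sq_nonneg _
      rw [e]
      have := mul_nonneg (mul_nonneg (by norm_num : (0:ℝ) ≤ 4) hs) hpos.le
      have := mul_nonneg (sq_nonneg (2 * s)) h2
      linarith
    have hEs : ∀ s : ℝ, 0 ≤ s → p (ρ.1 + (2 * s) • ρ.2, ρ.2) = E₀ := by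
      intro s hs
      rw [hF.free _ _ (hsq s hs), ← hF.free ρ.1 ρ.2 hR]
      exact hE
    have h1 := hunr (fun s => (ρ.1 + (2 * s) • ρ.2, ρ.2)) t ht (fun s hs => by
      rw [hvH _ (hEs s hs.1), Hvf_free hF _ (hsq s hs.1)]
      refine HasDerivAt.prodMk ?_ (hasDerivAt_const _ _)
      have := (((hasDerivAt_id s).const_mul 2).smul_const ρ.2).const_add ρ.1
      simpa using this)
    simp only [mul_zero, zero_smul, add_zero] at h1
    exact h1.symm

end SymAux

namespace SymAux
open Set

/-- The outgoing free region. -/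
def Out {n : ℕ} (R : ℝ) : Set ((Fin n → ℝ) × (Fin n → ℝ)) :=
  {ρ | R < ∑ i, ρ.1 i ^ 2 ∧ 0 < ∑ i, ρ.1 i * ρ.2 i}

lemma isOpen_Out {n : ℕ} (R : ℝ) : IsOpen (Out (n := n) R) := by
  have h1 : IsOpen {ρ : (Fin n → ℝ) × (Fin n → ℝ) | R < ∑ i, ρ.1 i ^ 2} :=
    isOpen_lt continuous_const (by fun_prop)
  have h2 : IsOpen {ρ : (Fin n → ℝ) × (Fin n → ℝ) | 0 < ∑ i, ρ.1 i * ρ.2 i} :=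
    isOpen_lt continuous_const (by fun_prop)
  exact h1.inter h2

variable {n : ℕ} {p : (Fin n → ℝ) × (Fin n → ℝ) → ℝ} {E₀ : ℝ}
    {q : (Fin n → ℝ) → (Fin n → ℝ) → ℝ} {δ R C : ℝ}
    {φ : (Fin n → ℝ) × (Fin n → ℝ) → ℝ → (Fin n → ℝ) × (Fin n → ℝ)}

lemma Out_forward (hφ : Flow p E₀ R φ) {ρ : (Fin n → ℝ) × (Fin n → ℝ)} (hE : p ρ = E₀)
    (h : ρ ∈ Out R) {t : ℝ} (ht : 0 ≤ t) : φ ρ t ∈ Out R := by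
  rw [hφ.free ρ hE h.1 h.2 t ht]
  have h2 : 0 ≤ ∑ i, ρ.2 i ^ 2 := Finset.sum_nonneg fun i _ => sq_nonneg _
  have hpos := h.2
  have hR := h.1
  constructor
  · have e : ∑ i, (ρ.1 + (2 * t) • ρ.2) i ^ 2 = ∑ i, ρ.1 i ^ 2 + 4 * t * ∑ i, ρ.1 i * ρ.2 i +
          (2 * t) ^ 2 * ∑ i, ρ.2 i ^ 2 := by
        simp only [Finset.mul_sum, ← Finset.sum_add_distrib]
        refine Finset.sum_congr rfl fun i _ => ?_
        simp; ring
    change R < ∑ i, (ρ.1 + (2 * t) • ρ.2) i ^ 2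
    rw [e]
    have := mul_nonneg (mul_nonneg (by norm_num : (0:ℝ) ≤ 4) ht) hpos.le
    have := mul_nonneg (sq_nonneg (2 * t)) h2
    linarith
  · have e : ∑ i, (ρ.1 + (2 * t) • ρ.2) i * ρ.2 i = ∑ i, ρ.1 i * ρ.2 i +
          (2 * t) * ∑ i, ρ.2 i ^ 2 := by
        simp only [Finset.mul_sum, ← Finset.sum_add_distrib]
        refine Finset.sum_congr rfl fun i _ => ?_
        simp; ring
    change 0 < ∑ i, (ρ.1 + (2 * t) • ρ.2) i * ρ.2 i
    rw [e]
    have := mul_nonneg (mul_nonneg (by norm_num : (0:ℝ) ≤ 2) ht) h2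
    linarith

lemma cont_t (hφ : Flow p E₀ R φ) (ρ : (Fin n → ℝ) × (Fin n → ℝ)) : Continuous (φ ρ) :=
  hφ.cont.comp (continuous_const.prodMk continuous_id)

lemma cont_x (hφ : Flow p E₀ R φ) (t : ℝ) : Continuous (fun ρ => φ ρ t) :=
  hφ.cont.comp (continuous_id.prodMk continuous_const)

lemma bounded_forward (hF : Facts p E₀ q δ R C) (hφ : Flow p E₀ R φ)
    {ρ : (Fin n → ℝ) × (Fin n → ℝ)} (hE : p ρ = E₀)
    (h : ∀ t : ℝ, 0 ≤ t → φ ρ t ∉ Out R) :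
    ∃ B : ℝ, ∀ t : ℝ, 0 ≤ t → ‖φ ρ t‖ ≤ B := by
  let M := max R (∑ i, ρ.1 i ^ 2)
  let f : ℝ → ℝ := fun t => ∑ i, (φ ρ t).1 i ^ 2
  have hct := cont_t hφ ρ
  have hfc : Continuous f := by
    have : Continuous fun σ : (Fin n → ℝ) × (Fin n → ℝ) => ∑ i, σ.1 i ^ 2 := by fun_prop
    exact this.comp hct
  have hfd : ∀ t, HasDerivAt f (∑ i, 2 * (φ ρ t).1 i * (Hvf p (φ ρ t)).1 i) t := by
    intro t
    refine HasDerivAt.fun_sum fun i _ => ?_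
    have h1 := hφ.deriv ρ t hE
    have h2 : HasDerivAt (fun s => (φ ρ s).1) (Hvf p (φ ρ t)).1 t :=
      (ContinuousLinearMap.fst ℝ (Fin n → ℝ) (Fin n → ℝ)).hasFDerivAt.comp_hasDerivAt t h1
    have h3 := (hasDerivAt_pi.1 h2 i).pow 2
    refine HasDerivAt.congr_deriv (f := fun t => (φ ρ t).1 i ^ 2) h3 ?_
    simp
  have key : ∀ t, 0 ≤ t → f t ≤ M := by
    intro t ht
    by_contra hcon
    push Not at hcon
    have hcomp : IsCompact (Icc 0 t ∩ {s | f s ≤ M}) :=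
      isCompact_Icc.inter_right (isClosed_le hfc continuous_const)
    have hne : (Icc 0 t ∩ {s | f s ≤ M}).Nonempty := by
      refine ⟨0, ⟨le_rfl, ht⟩, ?_⟩
      simp only [f, mem_ofPred_eq, hφ.zero]
      exact le_max_right _ _
    obtain ⟨s, hs, hmax⟩ := hcomp.exists_isGreatest hne
    have hst : s < t := by
      rcases hs.1.2.lt_or_eq with h1 | h1
      · exact h1
      · have := hs.2
        rw [mem_ofPred_eq, h1] at this
        linarith
    obtain ⟨c, hc, hcd⟩ := exists_hasDerivAt_eq_slope f _ hst hfc.continuousOn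
      (fun x _ => hfd x)
    have hfcM : M < f c := by
      by_contra h2
      push Not at h2
      have := hmax ⟨⟨hs.1.1.trans hc.1.le, hc.2.le⟩, h2⟩
      linarith [hc.1]
    have hRc : R < ∑ i, (φ ρ c).1 i ^ 2 := (le_max_left _ _).trans_lt hfcM
    have hpos : 0 < (f t - f s) / (t - s) := by
      have h1 : f s ≤ M := hs.2
      exact div_pos (by linarith) (by linarith)
    rw [← hcd, Hvf_free hF _ hRc] at hpos
    refine h c (hs.1.1.trans hc.1.le) ⟨hRc, ?_⟩
    have e : ∑ i, 2 * (φ ρ c).1 i * ((2:ℝ) • (φ ρ c).2) i = 4 * ∑ i, (φ ρ c).1 i * (φ ρ c).2 i := by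
      rw [Finset.mul_sum]
      refine Finset.sum_congr rfl fun i _ => ?_
      simp; ring
    change 0 < ∑ i, 2 * (φ ρ c).1 i * ((2:ℝ) • (φ ρ c).2) i at hpos
    rw [e] at hpos
    linarith
  refine ⟨max (Real.sqrt M) C, fun t ht => ?_⟩
  rw [Prod.norm_def]
  refine max_le_max ?_ (hF.bdd _ _ (hφ.energy ρ t hE))
  exact Real.le_sqrt_of_sq_le ((norm_sq_le_sum _).trans (key t ht))

lemma fiber_unique (hF : Facts p E₀ q δ R C) {ρ₀ : (Fin n → ℝ) × (Fin n → ℝ)}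
    (h0 : Hvf p ρ₀ = 0) (hE : p ρ₀ = E₀) {ρ : (Fin n → ℝ) × (Fin n → ℝ)} (h : p ρ = E₀)
    (hx : ρ.1 = ρ₀.1) : ρ = ρ₀ := by
  refine Prod.ext hx ?_
  have h1 := hF.expand ρ₀.1 ρ₀.2 (ρ.2 - ρ₀.2)
  rw [add_sub_cancel, ← hx, Prod.mk.eta, h] at h1
  rw [hx, Prod.mk.eta, hE, Hvf_zero h0] at h1
  have h2 := hF.qlow ρ₀.1 (ρ.2 - ρ₀.2)
  simp only [_root_.zero_apply, add_zero] at h1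
  have h3 : δ * ‖ρ.2 - ρ₀.2‖ ^ 2 ≤ 0 := by linarith
  have h4 : ‖ρ.2 - ρ₀.2‖ ^ 2 ≤ 0 := by
    by_contra hc
    push Not at hc
    have := mul_pos hF.δpos hc
    linarith
  have h5 : ‖ρ.2 - ρ₀.2‖ = 0 := by
    have := sq_nonneg ‖ρ.2 - ρ₀.2‖
    exact pow_eq_zero_iff (two_ne_zero) |>.1 (le_antisymm h4 this)
  exact sub_eq_zero.1 (norm_eq_zero.1 h5)

lemma fixed (hφ : Flow p E₀ R φ) {ρ₀ : (Fin n → ℝ) × (Fin n → ℝ)}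
    (h0 : Hvf p ρ₀ = 0) (hE : p ρ₀ = E₀) (t : ℝ) : φ ρ₀ t = ρ₀ :=
  (hφ.uniq (fun _ => ρ₀) (fun t => by rw [h0]; exact hasDerivAt_const _ _) hE t).symm

lemma fixed_inside (hF : Facts p E₀ q δ R C) (hE0 : 0 < E₀) {ρ₀ : (Fin n → ℝ) × (Fin n → ℝ)}
    (h0 : Hvf p ρ₀ = 0) (hE : p ρ₀ = E₀) : ∑ i, ρ₀.1 i ^ 2 ≤ R := by
  by_contra h
  push Not at h
  have h1 := Hvf_free hF ρ₀ h
  rw [h0] at h1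
  have h2 : ρ₀.2 = 0 := by
    have := (congrArg Prod.fst h1).symm
    simpa using this
  have := hF.free ρ₀.1 ρ₀.2 h
  rw [Prod.mk.eta, hE, h2] at this
  simp at this
  linarith

lemma proj_ne (hF : Facts p E₀ q δ R C) (hφ : Flow p E₀ R φ) {ρ₀ : (Fin n → ℝ) × (Fin n → ℝ)}
    (h0 : Hvf p ρ₀ = 0) (hE : p ρ₀ = E₀) {ρ : (Fin n → ℝ) × (Fin n → ℝ)} (h : p ρ = E₀)
    (hne : ρ ≠ ρ₀) (t : ℝ) : (φ ρ t).1 ≠ ρ₀.1 := by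
  intro hx
  have h1 := fiber_unique hF h0 hE (hφ.energy ρ t h) hx
  have h2 := hφ.add ρ t (-t)
  rw [h1, fixed hφ h0 hE, add_neg_cancel, hφ.zero] at h2
  exact hne h2.symm

lemma unif_time (hφ : Flow p E₀ R φ) {K : Set ((Fin n → ℝ) × (Fin n → ℝ))} (hK : IsCompact K)
    (hKE : ∀ ρ ∈ K, p ρ = E₀) (h : ∀ ρ ∈ K, ∃ t : ℝ, 0 ≤ t ∧ φ ρ t ∈ Out R) :
    ∃ T : ℝ, 0 ≤ T ∧ ∀ ρ ∈ K, φ ρ T ∈ Out R := by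
  have : ∃ T : ℝ, 0 ≤ T ∧ ∀ ρ ∈ K, p ρ = E₀ → φ ρ T ∈ Out R := by
    refine hK.induction_on (p := fun s => ∃ T : ℝ, 0 ≤ T ∧ ∀ ρ ∈ s, p ρ = E₀ → φ ρ T ∈ Out R)
      ⟨0, le_rfl, by simp⟩ ?_ ?_ ?_
    · rintro s t hst ⟨T, hT, h1⟩
      exact ⟨T, hT, fun ρ hρ => h1 ρ (hst hρ)⟩
    · rintro s t ⟨T, hT, h1⟩ ⟨T', hT', h2⟩
      refine ⟨T + T', by positivity, fun ρ hρ hE => ?_⟩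
      rcases hρ with hρ | hρ
      · rw [← hφ.add]
        exact Out_forward hφ (hφ.energy _ _ hE) (h1 ρ hρ hE) hT'
      · rw [add_comm, ← hφ.add]
        exact Out_forward hφ (hφ.energy _ _ hE) (h2 ρ hρ hE) hT
    · intro ρ hρ
      obtain ⟨t, ht, hO⟩ := h ρ hρ
      refine ⟨(fun σ => φ σ t) ⁻¹' Out R, mem_nhdsWithin_of_mem_nhds
        (((isOpen_Out R).preimage (cont_x hφ t)).mem_nhds hO), t, ht, fun σ hσ _ => hσ⟩
  obtain ⟨T, hT, h1⟩ := this
  exact ⟨T, hT, fun ρ hρ => h1 ρ hρ (hKE ρ hρ)⟩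

end SymAux

namespace SymAux
open Set Metric

variable {n : ℕ} {p : (Fin n → ℝ) × (Fin n → ℝ) → ℝ} {E₀ : ℝ}
    {q : (Fin n → ℝ) → (Fin n → ℝ) → ℝ} {δ R C : ℝ}
    {φ : (Fin n → ℝ) × (Fin n → ℝ) → ℝ → (Fin n → ℝ) × (Fin n → ℝ)}

/-- Trajectories starting where `Q > 0` leave the neighborhood. -/
lemma leaves (hφ : Flow p E₀ R φ) {ρ₂ v : (Fin n → ℝ) × (Fin n → ℝ)} {r₁ c : ℝ} (hc : 0 < c)
    {Q : (Fin n → ℝ) × (Fin n → ℝ) → ℝ} (hQ : Differentiable ℝ Q)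
    (hQc : ∀ ρ, dist ρ ρ₂ ≤ r₁ → c * Q ρ ≤ fderiv ℝ Q ρ (Hvf p ρ))
    (hE : p v = E₀) (hv : 0 < Q v) : ∃ t : ℝ, 0 ≤ t ∧ r₁ ≤ dist (φ v t) ρ₂ := by
  by_contra hcon
  push Not at hcon
  have hin : ∀ t : ℝ, 0 ≤ t → dist (φ v t) ρ₂ ≤ r₁ := fun t ht => (hcon t ht).le
  obtain ⟨M, hM⟩ := (isCompact_closedBall ρ₂ r₁).exists_bound_of_continuousOn
    hQ.continuous.continuousOn
  let h : ℝ → ℝ := fun t => Q (φ v t) * Real.exp (-(c * t))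
  have hd : ∀ t, HasDerivAt h (fderiv ℝ Q (φ v t) (Hvf p (φ v t)) * Real.exp (-(c * t)) +
      Q (φ v t) * (Real.exp (-(c * t)) * (-c))) t := by
    intro t
    have h1 := (hQ (φ v t)).hasFDerivAt.comp_hasDerivAt t (hφ.deriv v t hE)
    have h2 : HasDerivAt (fun t : ℝ => Real.exp (-(c * t))) (Real.exp (-(c * t)) * (-c)) t := by
      have h3 : HasDerivAt (fun t : ℝ => -(c * t)) (-c) t := by
        exact HasDerivAt.congr_deriv (f := fun t : ℝ => -(c * t))
          ((hasDerivAt_id t).const_mul c).neg (by simp)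
      exact h3.exp
    exact h1.mul h2
  have hmono : MonotoneOn h (Ici 0) := by
    refine monotoneOn_of_deriv_nonneg (convex_Ici 0)
      (fun t _ => (hd t).continuousAt.continuousWithinAt)
      (fun t _ => (hd t).differentiableAt.differentiableWithinAt) ?_
    intro t ht
    rw [interior_Ici, mem_Ioi] at ht
    rw [(hd t).deriv]
    have := hQc _ (hin t ht.le)
    have := mul_nonneg (sub_nonneg.2 this) (Real.exp_pos (-(c * t))).le
    linarith
  have hle : ∀ t : ℝ, 0 ≤ t → Q v * Real.exp (c * t) ≤ M := by
    intro t ht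
    have h1 : h 0 ≤ h t := hmono (mem_Ici.2 le_rfl) (mem_Ici.2 ht) ht
    simp only [h, hφ.zero, mul_zero, neg_zero, Real.exp_zero, mul_one] at h1
    have h2 : Q (φ v t) ≤ M := (le_abs_self _).trans (hM _ (mem_closedBall.2 (hin t ht)))
    have h3 : Real.exp (-(c * t)) * Real.exp (c * t) = 1 := by
      rw [← Real.exp_add]; simp
    calc Q v * Real.exp (c * t) ≤ Q (φ v t) * Real.exp (-(c * t)) * Real.exp (c * t) := by gcongr
      _ = Q (φ v t) := by rw [mul_assoc, h3, mul_one]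
      _ ≤ M := h2
  have hM0 : 0 ≤ M := by
    have := hle 0 le_rfl
    simp at this
    linarith
  have h4 := hle (M / (Q v * c)) (by positivity)
  have h5 := Real.add_one_le_exp (c * (M / (Q v * c)))
  have h6 : Q v * (c * (M / (Q v * c)) + 1) = M + Q v := by field_simp
  have h7 := mul_le_mul_of_nonneg_left h5 hv.le
  linarith

lemma near_fixed (hφ : Flow p E₀ R φ) {ρ₂ : (Fin n → ℝ) × (Fin n → ℝ)}
    (h0 : Hvf p ρ₂ = 0) (hE : p ρ₂ = E₀) {r₁ : ℝ} (hr : 0 < r₁) (T : ℝ) :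
    ∀ᶠ v in nhds ρ₂, ∀ t ∈ Icc 0 T, dist (φ v t) ρ₂ < r₁ := by
  have ho : IsOpen {z : ((Fin n → ℝ) × (Fin n → ℝ)) × ℝ | dist (φ z.1 z.2) ρ₂ < r₁} :=
    isOpen_lt (hφ.cont.dist continuous_const) continuous_const
  have := (isCompact_Icc (a := (0:ℝ)) (b := T)).eventually_forall_of_forall_eventually
    (x₀ := ρ₂) (P := fun v t => dist (φ v t) ρ₂ < r₁) (fun t _ => by
      refine ho.mem_nhds ?_
      simp only [mem_ofPred_eq, fixed hφ h0 hE, dist_self]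
      exact hr)
  exact this

lemma escape (hF : Facts p E₀ q δ R C) (hφ : Flow p E₀ R φ)
    {ρ₁ ρ₂ : (Fin n → ℝ) × (Fin n → ℝ)}
    (h0 : Hvf p ρ₂ = 0) (hE : p ρ₂ = E₀) {r₁ c : ℝ} (hr : 0 < r₁) (hc : 0 < c)
    (hr1 : r₁ < dist ρ₁ ρ₂)
    {Q : (Fin n → ℝ) × (Fin n → ℝ) → ℝ} (hQ : Differentiable ℝ Q)
    (hQc : ∀ ρ, dist ρ ρ₂ ≤ r₁ → c * Q ρ ≤ fderiv ℝ Q ρ (Hvf p ρ))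
    (htr : trappedSet p E₀ = {ρ₁, ρ₂} ∪ heteroclinicSet p ρ₁ ρ₂) :
    ∃ ε : ℝ, 0 < ε ∧ ∀ v, p v = E₀ → 0 < Q v → dist v ρ₂ < ε → ∃ t : ℝ, 0 ≤ t ∧ φ v t ∈ Out R := by
  by_contra hcon
  push Not at hcon
  choose v hvE hvQ hvd hvO using fun k : ℕ => hcon (min r₁ (1 / ((k:ℝ) + 1))) (by positivity)
  have hvlim : Tendsto v atTop (nhds ρ₂) := by
    rw [tendsto_iff_dist_tendsto_zero]
    exact squeeze_zero (fun _ => dist_nonneg) (fun k => (hvd k).le.trans (min_le_right _ _))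
      tendsto_one_div_add_atTop_nhds_zero_nat
  have hexit : ∀ k, ∃ τ : ℝ, 0 ≤ τ ∧ dist (φ (v k) τ) ρ₂ = r₁ ∧
      ∀ t, 0 ≤ t → t ≤ τ → dist (φ (v k) t) ρ₂ ≤ r₁ := by
    intro k
    obtain ⟨t, ht, hd⟩ := leaves hφ hc hQ hQc (hvE k) (hvQ k)
    have hcont : Continuous fun t => dist (φ (v k) t) ρ₂ :=
      (cont_t hφ (v k)).dist continuous_const
    have hcomp : IsCompact (Icc 0 t ∩ {s | r₁ ≤ dist (φ (v k) s) ρ₂}) :=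
      isCompact_Icc.inter_right (isClosed_le continuous_const hcont)
    obtain ⟨τ, hτ, hmin⟩ := hcomp.exists_isLeast ⟨t, ⟨ht, le_rfl⟩, hd⟩
    have hlt : ∀ s, 0 ≤ s → s < τ → dist (φ (v k) s) ρ₂ < r₁ := by
      intro s hs hsτ
      by_contra h
      push Not at h
      have := hmin ⟨⟨hs, hsτ.le.trans hτ.1.2⟩, h⟩
      linarith
    have hz : dist (φ (v k) 0) ρ₂ < r₁ := by
      rw [hφ.zero]; exact (hvd k).trans_le (min_le_left _ _)
    have heq : dist (φ (v k) τ) ρ₂ = r₁ := by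
      refine le_antisymm ?_ hτ.2
      by_contra hgt
      push Not at hgt
      obtain ⟨s, hs, hse⟩ := intermediate_value_Icc hτ.1.1 hcont.continuousOn
        (show r₁ ∈ Icc (dist (φ (v k) 0) ρ₂) (dist (φ (v k) τ) ρ₂) from ⟨hz.le, hgt.le⟩)
      have hse' : dist (φ (v k) s) ρ₂ = r₁ := hse
      rcases hs.2.lt_or_eq with h | h
      · exact absurd hse' (hlt s hs.1 h).ne
      · rw [h] at hse'; linarith
    refine ⟨τ, hτ.1.1, heq, fun s hs hsτ => ?_⟩
    rcases hsτ.lt_or_eq with h | h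
    · exact (hlt s hs h).le
    · rw [h]; exact heq.le
  choose τ hτ0 hτe hτin using hexit
  have hτlim : Tendsto τ atTop atTop := by
    rw [Filter.tendsto_atTop]
    intro T
    filter_upwards [hvlim.eventually (near_fixed hφ h0 hE hr T)] with k hk
    by_contra h
    push Not at h
    exact absurd (hτe k) (hk (τ k) ⟨hτ0 k, h.le⟩).ne
  obtain ⟨w, hwS, ψ, hψ, hwlim⟩ := (isCompact_sphere ρ₂ r₁).tendsto_subseq
    (x := fun k => φ (v k) (τ k)) (fun k => mem_sphere.2 (hτe k))
  have hwE : p w = E₀ := by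
    have h1 := (hF.smooth.continuous.tendsto w).comp hwlim
    have h2 : (p ∘ (fun k => φ (v k) (τ k)) ∘ ψ) = fun _ => E₀ := by
      funext k; exact hφ.energy _ _ (hvE _)
    rw [h2] at h1
    exact tendsto_nhds_unique h1 tendsto_const_nhds |>.symm ▸ rfl
  have hwO : ∀ t : ℝ, 0 ≤ t → φ w t ∉ Out R := by
    intro t ht hO
    have h1 := ((cont_x hφ t).tendsto w).comp hwlim
    obtain ⟨k, hk⟩ := (h1.eventually ((isOpen_Out R).mem_nhds hO)).exists
    simp only [Function.comp_apply, hφ.add] at hk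
    exact hvO _ _ (by have := hτ0 (ψ k); linarith) hk
  have hwB : ∀ t : ℝ, 0 ≤ t → dist (φ w (-t)) ρ₂ ≤ r₁ := by
    intro t ht
    have h1 := (((cont_x hφ (-t)).tendsto w).comp hwlim).dist
      (tendsto_const_nhds (x := ρ₂))
    refine le_of_tendsto h1 ?_
    filter_upwards [(hτlim.comp hψ.tendsto_atTop).eventually_ge_atTop t] with k hk
    simp only [Function.comp_apply, hφ.add] at hk ⊢
    exact hτin _ _ (by linarith) (by linarith)
  obtain ⟨B, hB⟩ := bounded_forward hF hφ hwE hwO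
  have hwT : w ∈ trappedSet p E₀ := by
    refine ⟨hwE, φ w, hφ.zero w, fun t => hφ.deriv w t hwE, ?_⟩
    refine ((isBounded_closedBall (x := (0 : (Fin n → ℝ) × (Fin n → ℝ))) (r := B)).union
      (isBounded_closedBall (x := ρ₂) (r := r₁))).subset ?_
    rintro _ ⟨t, rfl⟩
    rcases le_total 0 t with ht | ht
    · left; rw [mem_closedBall_zero_iff]; exact hB t ht
    · right; rw [mem_closedBall]
      have := hwB (-t) (by linarith)
      rwa [neg_neg] at this
  rw [htr] at hwT
  rw [mem_sphere] at hwS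
  rcases hwT with (h | h) | h
  · rw [h] at hwS; linarith
  · rw [mem_singleton_iff.1 h, dist_self] at hwS; linarith
  · obtain ⟨γ, hγ, hγb, -, s, hs⟩ := h
    have h1 : ∀ t, γ (s + t) = φ w t := by
      intro t
      have := hφ.uniq (fun t => γ (s + t)) (fun t => by
        simpa using (hγ (s + t)).comp_const_add s t) (by simp [hs, hwE]) t
      simpa [hs] using this
    have h2 : Tendsto (fun t : ℝ => φ w (-t)) atTop (nhds ρ₁) := by
      have h3 : Tendsto (fun t : ℝ => s + -t) atTop atBot :=
        tendsto_atBot_add_const_left _ _ tendsto_neg_atTop_atBot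
      have h4 := hγb.comp h3
      refine h4.congr fun t => ?_
      exact h1 (-t)
    have h5 := le_of_tendsto (h2.dist (tendsto_const_nhds (x := ρ₂)))
      (by filter_upwards [eventually_ge_atTop 0] with t ht using hwB t ht)
    linarith

lemma main_contra (hn : 1 ≤ n) (hF : Facts p E₀ q δ R C) (hE0 : 0 < E₀)
    {ρ₁ ρ₂ : (Fin n → ℝ) × (Fin n → ℝ)} (hne : ρ₁ ≠ ρ₂)
    (h01 : Hvf p ρ₁ = 0) (hE1 : p ρ₁ = E₀)
    (h02 : Hvf p ρ₂ = 0) (hE2 : p ρ₂ = E₀) {r₁ c Cs : ℝ} (hr : 0 < r₁) (hc : 0 < c)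
    {Q : (Fin n → ℝ) × (Fin n → ℝ) → ℝ} (hQ : Differentiable ℝ Q)
    (hQc : ∀ ρ, dist ρ ρ₂ ≤ r₁ → c * Q ρ ≤ fderiv ℝ Q ρ (Hvf p ρ))
    (sec : (Fin n → ℝ) → (Fin n → ℝ))
    (hsc : ContinuousOn sec (ball ρ₂.1 r₁ \ {ρ₂.1}))
    (hsec : ∀ x ∈ ball ρ₂.1 r₁ \ {ρ₂.1}, p (x, sec x) = E₀ ∧ 0 < Q (x, sec x) ∧
      dist (sec x) ρ₂.2 ≤ Cs * dist x ρ₂.1)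
    (htr : trappedSet p E₀ = {ρ₁, ρ₂} ∪ heteroclinicSet p ρ₁ ρ₂) : False := by
  obtain ⟨φ, hφ⟩ := exists_Flow hF
  have hd : 0 < dist ρ₁ ρ₂ := dist_pos.2 hne
  have hx12 : ρ₁.1 ≠ ρ₂.1 := fun h => hne (fiber_unique hF h02 hE2 hE1 h)
  have hx12p : 0 < ‖ρ₁.1 - ρ₂.1‖ := norm_pos_iff.2 (sub_ne_zero.2 hx12)
  obtain ⟨ε, hε, hesc⟩ := escape (ρ₁ := ρ₁) hF hφ h02 hE2 (r₁ := min r₁ (dist ρ₁ ρ₂ / 2))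
    (by positivity) hc ((min_le_right _ _).trans_lt (by linarith)) hQ
    (fun ρ h => hQc ρ (h.trans (min_le_left _ _))) htr
  obtain ⟨r, hr0, hrr, hrx, hrε, hrC⟩ : ∃ r : ℝ, 0 < r ∧ r < r₁ ∧ r < ‖ρ₁.1 - ρ₂.1‖ ∧ r < ε ∧
      Cs * r < ε := by
    have h1 : ∀ᶠ r : ℝ in nhdsWithin 0 (Ioi 0), r < r₁ ∧ r < ‖ρ₁.1 - ρ₂.1‖ ∧ r < ε ∧
        Cs * r < ε := by
      have h2 : ∀ᶠ r : ℝ in nhds 0, r < r₁ ∧ r < ‖ρ₁.1 - ρ₂.1‖ ∧ r < ε ∧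
        Cs * r < ε := by
        refine (eventually_lt_nhds hr).and ((eventually_lt_nhds hx12p).and
          ((eventually_lt_nhds hε).and ?_))
        have : Continuous fun r : ℝ => Cs * r := by fun_prop
        exact (this.tendsto 0).eventually_lt_const (by simpa using hε)
      exact mem_nhdsWithin_of_mem_nhds h2
    obtain ⟨r, h, h'⟩ := (h1.and self_mem_nhdsWithin).exists
    exact ⟨r, h', h⟩
  have hmem : ∀ u : Fin n → ℝ, ‖u‖ = r → ρ₂.1 + u ∈ ball ρ₂.1 r₁ \ {ρ₂.1} := by
    intro u hu
    refine ⟨by simp [mem_ball, hu, hrr], ?_⟩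
    intro h
    have : u = 0 := by simpa using h
    rw [this, norm_zero] at hu
    linarith
  let V : (Fin n → ℝ) → (Fin n → ℝ) × (Fin n → ℝ) := fun u => (ρ₂.1 + u, sec (ρ₂.1 + u))
  have hVc : ContinuousOn V (sphere 0 r) := by
    have h1 : ContinuousOn (fun u : Fin n → ℝ => ρ₂.1 + u) (sphere 0 r) := by fun_prop
    exact h1.prodMk (hsc.comp h1 fun u hu => hmem u (mem_sphere_zero_iff_norm.1 hu))
  have hVE : ∀ u, ‖u‖ = r → p (V u) = E₀ := fun u hu => (hsec _ (hmem u hu)).1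
  have hVO : ∀ u, ‖u‖ = r → ∃ t : ℝ, 0 ≤ t ∧ φ (V u) t ∈ Out R := by
    intro u hu
    obtain ⟨a, b, d⟩ := hsec _ (hmem u hu)
    refine hesc _ a b ?_
    have hdu : dist (ρ₂.1 + u) ρ₂.1 = r := by simp [hu]
    rw [hdu] at d
    rw [Prod.dist_eq, max_lt_iff]
    exact ⟨hdu.trans_lt hrε, d.trans_lt hrC⟩
  obtain ⟨T, hT, hTO⟩ := unif_time hφ ((isCompact_sphere (0 : Fin n → ℝ) r).image_of_continuousOn hVc)
    (by rintro _ ⟨u, hu, rfl⟩; exact hVE u (mem_sphere_zero_iff_norm.1 hu))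
    (by rintro _ ⟨u, hu, rfl⟩; exact hVO u (mem_sphere_zero_iff_norm.1 hu))
  have hne2 : ∀ u, ‖u‖ = r → V u ≠ ρ₂ := by
    intro u hu h
    exact (hmem u hu).2 (congrArg Prod.fst h)
  have hne1 : ∀ u, ‖u‖ = r → V u ≠ ρ₁ := by
    intro u hu h
    have h1 : ρ₂.1 + u = ρ₁.1 := congrArg Prod.fst h
    rw [← h1, add_sub_cancel_left, hu] at hrx
    exact lt_irrefl _ hrx
  refine TopAux.topological_obstruction hn ρ₁.1 ρ₂.1 r T hr0 hT hrx (fun u t => (φ (V u) t).1)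
    ?_ ?_ ?_ ?_ ?_
  · have h1 : ContinuousOn (fun z : (Fin n → ℝ) × ℝ => (V z.1, z.2)) (sphere 0 r ×ˢ Icc 0 T) :=
      (hVc.comp continuousOn_fst fun z hz => hz.1).prodMk continuousOn_snd
    exact continuous_fst.comp_continuousOn (hφ.cont.comp_continuousOn h1)
  · intro u hu
    simp only [hφ.zero, V]
  · intro u hu t ht
    exact proj_ne hF hφ h01 hE1 (hVE u hu) (hne1 u hu) t
  · intro u hu t ht
    exact proj_ne hF hφ h02 hE2 (hVE u hu) (hne2 u hu) t
  · intro u hu s hs h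
    have hO := (hTO _ ⟨u, mem_sphere_zero_iff_norm.2 hu, rfl⟩).1
    rw [h] at hO
    have a1 := fixed_inside hF hE0 h01 hE1
    have a2 := fixed_inside hF hE0 h02 hE2
    have hcv : ∑ i, (ρ₂.1 + s • (ρ₁.1 - ρ₂.1)) i ^ 2 ≤
        (1 - s) * ∑ i, ρ₂.1 i ^ 2 + s * ∑ i, ρ₁.1 i ^ 2 := by
      rw [Finset.mul_sum, Finset.mul_sum, ← Finset.sum_add_distrib]
      refine Finset.sum_le_sum fun i _ => ?_
      simp only [Pi.add_apply, Pi.smul_apply, Pi.sub_apply, smul_eq_mul]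
      have := mul_nonneg (mul_nonneg hs.1 (sub_nonneg.2 hs.2)) (sq_nonneg (ρ₁.1 i - ρ₂.1 i))
      nlinarith
    have b1 := mul_le_mul_of_nonneg_left a2 (sub_nonneg.2 hs.2)
    have b2 := mul_le_mul_of_nonneg_left a1 hs.1
    linarith

end SymAux

namespace SymAux
open Set Metric

lemma quad_root (P0 P1 P2 : ℝ) (h1 : 0 < P1) (hD : 0 ≤ P1 ^ 2 - 4 * P2 * P0) :
    P0 + P1 * (-2 * P0 / (P1 + Real.sqrt (P1 ^ 2 - 4 * P2 * P0))) +
      P2 * (-2 * P0 / (P1 + Real.sqrt (P1 ^ 2 - 4 * P2 * P0))) ^ 2 = 0 ∧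
    |(-2 * P0 / (P1 + Real.sqrt (P1 ^ 2 - 4 * P2 * P0)))| ≤ 2 * |P0| / P1 := by
  have hs := Real.sq_sqrt hD
  have hs0 := Real.sqrt_nonneg (P1 ^ 2 - 4 * P2 * P0)
  generalize Real.sqrt (P1 ^ 2 - 4 * P2 * P0) = S at *
  have hW : 0 < P1 + S := by linarith
  constructor
  · have hne := hW.ne'
    field_simp
    linear_combination P0 * hs
  · rw [abs_div, abs_of_pos hW, abs_mul]
    norm_num
    gcongr
    linarith

lemma taylor_one {X : Type*} [NormedAddCommGroup X] [NormedSpace ℝ X] {p : X → ℝ}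
    (hp : ContDiff ℝ 2 p) (ρ : X) (h0 : fderiv ℝ p ρ = 0) {ε : ℝ} (hε : 0 < ε) :
    ∃ r : ℝ, 0 < r ∧ ∀ k : X, ‖k‖ ≤ r →
      ‖fderiv ℝ p (ρ + k) - fderiv ℝ (fderiv ℝ p) ρ k‖ ≤ ε * ‖k‖ := by
  have h1 : ContDiff ℝ 1 (fderiv ℝ p) := hp.fderiv_right (m := 1) (by norm_num)
  have h2 := (h1.differentiable (by simp) ρ).hasFDerivAt
  rw [hasFDerivAt_iff_isLittleO_nhds_zero] at h2
  have h3 := h2.def hε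
  rw [Metric.eventually_nhds_iff] at h3
  obtain ⟨r, hr, h⟩ := h3
  refine ⟨r / 2, by positivity, fun k hk => ?_⟩
  have := h (y := k) (by rw [dist_zero_right]; linarith)
  rwa [h0, sub_zero] at this

lemma taylor_two {X : Type*} [NormedAddCommGroup X] [NormedSpace ℝ X] {p : X → ℝ}
    (hp : ContDiff ℝ 2 p) (ρ : X) {ε r : ℝ} (hε : 0 < ε)
    (h : ∀ k : X, ‖k‖ ≤ r →
      ‖fderiv ℝ p (ρ + k) - fderiv ℝ (fderiv ℝ p) ρ k‖ ≤ ε * ‖k‖) (k : X) (hk : ‖k‖ ≤ r) :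
    |p (ρ + k) - p ρ - fderiv ℝ (fderiv ℝ p) ρ k k / 2| ≤ ε * ‖k‖ ^ 2 := by
  let B := fderiv ℝ (fderiv ℝ p) ρ
  let g : ℝ → ℝ := fun t => p (ρ + t • k) - t ^ 2 * (B k k / 2)
  have hd : ∀ t, HasDerivAt g (fderiv ℝ p (ρ + t • k) k - t * B k k) t := by
    intro t
    have h1 : HasDerivAt (fun t : ℝ => ρ + t • k) k t := by
      simpa using ((hasDerivAt_id t).smul_const k).const_add ρ
    have h2 := (hp.differentiable (by simp) (ρ + t • k)).hasFDerivAt.comp_hasDerivAt t h1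
    have h3 := ((hasDerivAt_id t).pow 2).mul_const (B k k / 2)
    refine HasDerivAt.congr_deriv (f := g) (h2.sub h3) ?_
    simp; ring
  have hb : ∀ t ∈ Ico (0:ℝ) 1, ‖fderiv ℝ p (ρ + t • k) k - t * B k k‖ ≤ ε * ‖k‖ ^ 2 := by
    intro t ht
    have hn : ‖t • k‖ ≤ ‖k‖ := by
      rw [norm_smul, Real.norm_eq_abs, abs_of_nonneg ht.1]
      exact mul_le_of_le_one_left (norm_nonneg _) ht.2.le
    have h1 := h (t • k) (hn.trans hk)
    have h2 : fderiv ℝ p (ρ + t • k) k - t * B k k = (fderiv ℝ p (ρ + t • k) - B (t • k)) k := by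
      simp
    rw [h2]
    calc _ ≤ ‖fderiv ℝ p (ρ + t • k) - B (t • k)‖ * ‖k‖ := ContinuousLinearMap.le_opNorm _ _
      _ ≤ ε * ‖k‖ * ‖k‖ := by
        gcongr
        exact h1.trans (by gcongr)
      _ = _ := by ring
  have := norm_image_sub_le_of_norm_deriv_le_segment_01' (f := g)
    (fun t _ => (hd t).hasDerivWithinAt) hb
  simp only [g, one_smul, zero_smul, add_zero, one_pow, one_mul, ne_eq, OfNat.ofNat_ne_zero,
    not_false_eq_true, zero_pow, zero_mul, sub_zero] at this
  rw [Real.norm_eq_abs] at this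
  convert this using 2
  ring

lemma taylor_lim {X : Type*} [NormedAddCommGroup X] [NormedSpace ℝ X] {p : X → ℝ}
    (hp : ContDiff ℝ 2 p) (ρ : X) (h0 : fderiv ℝ p ρ = 0) (m : ℝ → X) (m0 : X)
    (hm : Tendsto m (nhdsWithin 0 (Ioi 0)) (nhds m0)) :
    Tendsto (fun t : ℝ => (p (ρ + t • m t) - p ρ) / t ^ 2) (nhdsWithin 0 (Ioi 0))
      (nhds (fderiv ℝ (fderiv ℝ p) ρ m0 m0 / 2)) := by
  let B := fderiv ℝ (fderiv ℝ p) ρ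
  have h1 : Tendsto (fun t => B (m t) (m t) / 2) (nhdsWithin 0 (Ioi 0)) (nhds (B m0 m0 / 2)) := by
    have : Continuous fun y : X => B y y / 2 := by fun_prop
    exact (this.tendsto m0).comp hm
  have h2 : Tendsto (fun t : ℝ => (p (ρ + t • m t) - p ρ) / t ^ 2 - B (m t) (m t) / 2)
      (nhdsWithin 0 (Ioi 0)) (nhds 0) := by
    rw [Metric.tendsto_nhds]
    intro ε hε
    let ε' := ε / (2 * (‖m0‖ + 1) ^ 2)
    have hε' : 0 < ε' := by positivity
    obtain ⟨r, hr, hB⟩ := taylor_one hp ρ h0 hε'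
    have hmb : ∀ᶠ t in nhdsWithin 0 (Ioi 0), ‖m t‖ < ‖m0‖ + 1 :=
      hm.norm.eventually_lt_const (by linarith)
    have hlim : Tendsto (fun t : ℝ => t • m t) (nhdsWithin 0 (Ioi 0)) (nhds 0) := by
      have : Tendsto (fun t : ℝ => t) (nhdsWithin 0 (Ioi 0)) (nhds 0) :=
        tendsto_id.mono_left nhdsWithin_le_nhds
      simpa using this.smul hm
    have hsm : ∀ᶠ t in nhdsWithin (0:ℝ) (Ioi 0), ‖t • m t‖ < r :=
      hlim.norm.eventually_lt_const (by simpa using hr)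
    filter_upwards [hmb, hsm, self_mem_nhdsWithin] with t ht1 ht2 ht3
    have htp : 0 < t := ht3
    have h3 := taylor_two hp ρ hε' hB (t • m t) ht2.le
    have e : (p (ρ + t • m t) - p ρ) / t ^ 2 - B (m t) (m t) / 2 =
        (p (ρ + t • m t) - p ρ - B (t • m t) (t • m t) / 2) / t ^ 2 := by
      simp
      field_simp
    rw [dist_zero_right, Real.norm_eq_abs, e, abs_div, abs_of_pos (pow_pos htp 2),
      div_lt_iff₀ (pow_pos htp 2)]
    refine h3.trans_lt ?_
    rw [norm_smul, Real.norm_eq_abs, abs_of_pos htp, mul_pow]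
    have h4 : ‖m t‖ ^ 2 ≤ (‖m0‖ + 1) ^ 2 := by gcongr
    have h5 : ε' * ‖m t‖ ^ 2 < ε := by
      calc ε' * ‖m t‖ ^ 2 ≤ ε' * (‖m0‖ + 1) ^ 2 := by gcongr
        _ = ε / 2 := by simp only [ε']; field_simp
        _ < ε := by linarith
    have := mul_lt_mul_of_pos_right h5 (pow_pos htp 2)
    linarith
  have := h2.add h1
  simpa using this

/-- Linear normal form at a hyperbolic fixed point. -/
lemma linear_form {n : ℕ} {p : (Fin n → ℝ) × (Fin n → ℝ) → ℝ} {E₀ : ℝ}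
    {ρ₀ : (Fin n → ℝ) × (Fin n → ℝ)} (hp : ContDiff ℝ 2 p) (h : IsHyperbolicFixedPt p E₀ ρ₀) :
    ∃ (A : ((Fin n → ℝ) × (Fin n → ℝ)) ≃L[ℝ] ((Fin n → ℝ) × (Fin n → ℝ))) (lam : Fin n → ℝ),
      (∀ k, 0 < lam k) ∧ (∀ u v, stdSymplectic (A u) (A v) = stdSymplectic u v) ∧
      ∀ u v, fderiv ℝ (fderiv ℝ p) ρ₀ (A u) (A v) =
        ∑ k, lam k * (u.2 k * v.2 k - u.1 k * v.1 k) := by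
  obtain ⟨h0, hE, U, κ, lam, C, hU, hmem, hκ, -, -, hfix, hsymp, hlam, hest⟩ := h
  have hD0 := Hvf_zero h0
  let A := fderiv ℝ κ ρ₀
  have hAs : ∀ u v, stdSymplectic (A u) (A v) = stdSymplectic u v := hsymp ρ₀ hmem
  have hinj : Function.Injective A.toLinearMap := by
    rw [injective_iff_map_eq_zero]
    intro u hu
    have h1 := hAs u (u.2, -u.1)
    have hu' : A u = 0 := hu
    rw [hu'] at h1
    simp only [stdSymplectic, Prod.fst_zero, Prod.snd_zero, Pi.zero_apply, zero_mul,
      Finset.sum_const_zero, sub_zero, Pi.neg_apply, mul_neg, Finset.sum_neg_distrib,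
      sub_neg_eq_add] at h1
    have a1 := norm_sq_le_sum u.1
    have a2 := norm_sq_le_sum u.2
    simp only [sq] at a1 a2
    have b1 : ‖u.1‖ = 0 := by nlinarith [norm_nonneg u.1, norm_nonneg u.2]
    have b2 : ‖u.2‖ = 0 := by nlinarith [norm_nonneg u.1, norm_nonneg u.2]
    exact Prod.ext (norm_eq_zero.1 b1) (norm_eq_zero.1 b2)
  let Ae := (LinearEquiv.ofInjectiveEndo A.toLinearMap hinj).toContinuousLinearEquiv
  have hAe : ∀ u, Ae u = A u := fun u => rfl
  let B := fderiv ℝ (fderiv ℝ p) ρ₀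
  have hBs : ∀ u v, B u v = B v u := by
    have := (hp.contDiffAt (x := ρ₀)).isSymmSndFDerivAt (by simp)
    exact fun u v => this u v
  have hdiag : ∀ u, B (A u) (A u) = ∑ k, lam k * (u.2 k ^ 2 - u.1 k ^ 2) := by
    intro u
    let m : ℝ → (Fin n → ℝ) × (Fin n → ℝ) := fun t => t⁻¹ • (κ (ρ₀ + t • u) - ρ₀)
    have hκd : HasFDerivAt κ A ρ₀ :=
      ((hκ.contDiffAt (hU.mem_nhds hmem)).differentiableAt (by simp)).hasFDerivAt
    have hm : Tendsto m (nhdsWithin 0 (Ioi 0)) (nhds (A u)) := by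
      have h1 : HasDerivAt (fun t : ℝ => ρ₀ + t • u) u 0 := by
        simpa using ((hasDerivAt_id (0:ℝ)).smul_const u).const_add ρ₀
      have hκd' : HasFDerivAt κ A (ρ₀ + (0:ℝ) • u) := by simpa using hκd
      have h2 : HasDerivAt (fun t : ℝ => κ (ρ₀ + t • u)) (A u) 0 :=
        hκd'.comp_hasDerivAt (0:ℝ) h1
      have h3 := h2.tendsto_slope_zero_right
      simpa [m, hfix] using h3
    have hlim := taylor_lim hp ρ₀ hD0 m (A u) hm
    have hlim2 : Tendsto (fun t : ℝ => (p (ρ₀ + t • m t) - p ρ₀) / t ^ 2) (nhdsWithin 0 (Ioi 0))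
        (nhds ((∑ k, lam k * (u.2 k ^ 2 - u.1 k ^ 2)) / 2)) := by
      rw [tendsto_iff_dist_tendsto_zero]
      have hbound : ∀ᶠ t : ℝ in nhdsWithin 0 (Ioi 0),
          dist ((p (ρ₀ + t • m t) - p ρ₀) / t ^ 2)
            ((∑ k, lam k * (u.2 k ^ 2 - u.1 k ^ 2)) / 2) ≤ C * ‖u‖ ^ 3 * t := by
        have hUev : ∀ᶠ t : ℝ in nhdsWithin 0 (Ioi 0), ρ₀ + t • u ∈ U := by
          have hc : Continuous fun t : ℝ => ρ₀ + t • u := by fun_prop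
          exact mem_nhdsWithin_of_mem_nhds
            ((hU.preimage hc).mem_nhds (by simpa using hmem))
        filter_upwards [hUev, self_mem_nhdsWithin] with t htU ht
        have htp : 0 < t := ht
        have h1 := hest _ htU
        have e1 : ρ₀ + t • m t = κ (ρ₀ + t • u) := by
          simp only [m, smul_smul, mul_inv_cancel₀ htp.ne', one_smul, add_sub_cancel]
        have e2 : ∑ k, lam k / 2 * (((ρ₀ + t • u).2 k - ρ₀.2 k) ^ 2 -
            ((ρ₀ + t • u).1 k - ρ₀.1 k) ^ 2) =
            t ^ 2 * ((∑ k, lam k * (u.2 k ^ 2 - u.1 k ^ 2)) / 2) := by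
          rw [Finset.sum_div, Finset.mul_sum]
          refine Finset.sum_congr rfl fun k _ => ?_
          simp; ring
        rw [e2, add_sub_cancel_left, norm_smul, Real.norm_eq_abs, abs_of_pos htp] at h1
        rw [e1, hE, Real.dist_eq]
        have e3 : (p (κ (ρ₀ + t • u)) - E₀) / t ^ 2 -
            (∑ k, lam k * (u.2 k ^ 2 - u.1 k ^ 2)) / 2 =
            (p (κ (ρ₀ + t • u)) - (E₀ + t ^ 2 *
              ((∑ k, lam k * (u.2 k ^ 2 - u.1 k ^ 2)) / 2))) / t ^ 2 := by
          field_simp; ring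
        rw [e3, abs_div, abs_of_pos (pow_pos htp 2), div_le_iff₀ (pow_pos htp 2)]
        linarith
      refine squeeze_zero' (Eventually.of_forall fun _ => dist_nonneg) hbound ?_
      have : Continuous fun t : ℝ => C * ‖u‖ ^ 3 * t := by fun_prop
      have h2 := this.tendsto 0
      rw [mul_zero] at h2
      exact h2.mono_left nhdsWithin_le_nhds
    have := tendsto_nhds_unique hlim hlim2
    change B (A u) (A u) / 2 = _ at this
    linarith
  refine ⟨Ae, lam, hlam, fun u v => hAs u v, fun u v => ?_⟩
  change B (A u) (A v) = _
  have h1 := hdiag (u + v)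
  have h2 := hdiag u
  have h3 := hdiag v
  have h4 := hBs (A u) (A v)
  simp only [map_add, _root_.add_apply, Prod.fst_add, Prod.snd_add, Pi.add_apply] at h1
  have e : ∑ k, lam k * ((u.2 k + v.2 k) ^ 2 - (u.1 k + v.1 k) ^ 2) =
      ∑ k, lam k * (u.2 k ^ 2 - u.1 k ^ 2) + ∑ k, lam k * (v.2 k ^ 2 - v.1 k ^ 2) +
      2 * ∑ k, lam k * (u.2 k * v.2 k - u.1 k * v.1 k) := by
    rw [Finset.mul_sum, ← Finset.sum_add_distrib, ← Finset.sum_add_distrib]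
    refine Finset.sum_congr rfl fun k _ => ?_
    ring
  rw [e] at h1
  linarith

end SymAux

namespace SymAux
open Set Metric

variable {n : ℕ} {p : (Fin n → ℝ) × (Fin n → ℝ) → ℝ} {E₀ : ℝ}
    {q : (Fin n → ℝ) → (Fin n → ℝ) → ℝ} {δ R C : ℝ}

/-- The quadratic escape function. -/
noncomputable def Qf (A : ((Fin n → ℝ) × (Fin n → ℝ)) ≃L[ℝ] ((Fin n → ℝ) × (Fin n → ℝ)))
    (ρ₀ ρ : (Fin n → ℝ) × (Fin n → ℝ)) : ℝ :=
  ∑ i, (A.symm (ρ - ρ₀)).1 i * (A.symm (ρ - ρ₀)).2 i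

lemma Qf_hasFDerivAt (A : ((Fin n → ℝ) × (Fin n → ℝ)) ≃L[ℝ] ((Fin n → ℝ) × (Fin n → ℝ)))
    (ρ₀ ρ : (Fin n → ℝ) × (Fin n → ℝ)) : Differentiable ℝ (Qf A ρ₀) ∧
    ∀ v, fderiv ℝ (Qf A ρ₀) ρ v = ∑ i, ((A.symm (ρ - ρ₀)).1 i * (A.symm v).2 i +
      (A.symm v).1 i * (A.symm (ρ - ρ₀)).2 i) := by
  let l1 : Fin n → ((Fin n → ℝ) × (Fin n → ℝ)) →L[ℝ] ℝ := fun i =>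
    (ContinuousLinearMap.proj (R := ℝ) (φ := fun _ : Fin n => ℝ) i).comp
      ((ContinuousLinearMap.fst ℝ (Fin n → ℝ) (Fin n → ℝ)).comp A.symm.toContinuousLinearMap)
  let l2 : Fin n → ((Fin n → ℝ) × (Fin n → ℝ)) →L[ℝ] ℝ := fun i =>
    (ContinuousLinearMap.proj (R := ℝ) (φ := fun _ : Fin n => ℝ) i).comp
      ((ContinuousLinearMap.snd ℝ (Fin n → ℝ) (Fin n → ℝ)).comp A.symm.toContinuousLinearMap)
  have hQ : Qf A ρ₀ = fun ρ => ∑ i, l1 i (ρ - ρ₀) * l2 i (ρ - ρ₀) := rfl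
  have hd : ∀ ρ, HasFDerivAt (Qf A ρ₀)
      (∑ i, (l1 i (ρ - ρ₀) • l2 i + l2 i (ρ - ρ₀) • l1 i)) ρ := by
    intro ρ
    rw [hQ]
    refine HasFDerivAt.fun_sum fun i _ => ?_
    have h1 : HasFDerivAt (fun ρ => l1 i (ρ - ρ₀)) (l1 i) ρ := by
      exact (l1 i).hasFDerivAt.comp ρ ((hasFDerivAt_id ρ).sub_const ρ₀)
    have h2 : HasFDerivAt (fun ρ => l2 i (ρ - ρ₀)) (l2 i) ρ := by
      exact (l2 i).hasFDerivAt.comp ρ ((hasFDerivAt_id ρ).sub_const ρ₀)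
    exact h1.mul h2
  refine ⟨fun ρ => (hd ρ).differentiableAt, fun v => ?_⟩
  rw [(hd ρ).fderiv]
  simp only [_root_.sum_apply, _root_.add_apply, _root_.smul_apply, smul_eq_mul]
  refine Finset.sum_congr rfl fun i _ => ?_
  change (A.symm (ρ - ρ₀)).1 i * (A.symm v).2 i + (A.symm (ρ - ρ₀)).2 i * (A.symm v).1 i = _
  ring

lemma Qf_growth {ρ₀ : (Fin n → ℝ) × (Fin n → ℝ)}
    (hp : ContDiff ℝ 2 p) (h0 : Hvf p ρ₀ = 0)
    (A : ((Fin n → ℝ) × (Fin n → ℝ)) ≃L[ℝ] ((Fin n → ℝ) × (Fin n → ℝ))) (lam : Fin n → ℝ)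
    {l0 : ℝ} (hl0 : 0 < l0) (hlam : ∀ k, l0 ≤ lam k)
    (hA : ∀ u v, stdSymplectic (A u) (A v) = stdSymplectic u v)
    (hB : ∀ u v, fderiv ℝ (fderiv ℝ p) ρ₀ (A u) (A v) =
        ∑ k, lam k * (u.2 k * v.2 k - u.1 k * v.1 k)) :
    ∃ r : ℝ, 0 < r ∧ ∀ ρ, dist ρ ρ₀ ≤ r → l0 * Qf A ρ₀ ρ ≤ fderiv ℝ (Qf A ρ₀) ρ (Hvf p ρ) := by
  let a := ‖A.toContinuousLinearMap‖ + 1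
  have ha : 0 < a := by positivity
  have hAa : ∀ z, ‖A z‖ ≤ a * ‖z‖ := fun z =>
    (A.toContinuousLinearMap.le_opNorm z).trans (by
      gcongr; simp [a])
  obtain ⟨r, hr, hT⟩ := taylor_one hp ρ₀ (Hvf_zero h0) (ε := l0 / (2 * a ^ 2)) (by positivity)
  refine ⟨r, hr, fun ρ hρ => ?_⟩
  rw [(Qf_hasFDerivAt A ρ₀ ρ).2]
  let z := A.symm (ρ - ρ₀)
  let w := A.symm (Hvf p ρ)
  let y : (Fin n → ℝ) × (Fin n → ℝ) := (z.1, -z.2)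
  have hAz : A z = ρ - ρ₀ := A.apply_symm_apply _
  have hAw : A w = Hvf p ρ := A.apply_symm_apply _
  have e1 : ∑ i, (z.1 i * w.2 i + w.1 i * z.2 i) = -fderiv ℝ p ρ (A y) := by
    rw [fderiv_eq, neg_neg, ← hAw, hA, stdSymplectic, ← Finset.sum_sub_distrib]
    refine Finset.sum_congr rfl fun i _ => ?_
    simp only [y, Pi.neg_apply]; ring
  change l0 * ∑ i, z.1 i * z.2 i ≤ ∑ i, (z.1 i * w.2 i + w.1 i * z.2 i)
  rw [e1]
  have e2 : fderiv ℝ (fderiv ℝ p) ρ₀ (ρ - ρ₀) (A y) =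
      - ∑ k, lam k * (z.1 k ^ 2 + z.2 k ^ 2) := by
    rw [← hAz, hB, ← Finset.sum_neg_distrib]
    refine Finset.sum_congr rfl fun i _ => ?_
    simp only [y, Pi.neg_apply]; ring
  have e3 := hT (ρ - ρ₀) (by rwa [← dist_eq_norm])
  rw [add_sub_cancel] at e3
  have hy : ‖y‖ = ‖z‖ := by simp [y, Prod.norm_def]
  have e4 : |(fderiv ℝ p ρ - fderiv ℝ (fderiv ℝ p) ρ₀ (ρ - ρ₀)) (A y)| ≤ l0 / 2 * ‖z‖ ^ 2 := by
    calc |(fderiv ℝ p ρ - fderiv ℝ (fderiv ℝ p) ρ₀ (ρ - ρ₀)) (A y)|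
        ≤ ‖fderiv ℝ p ρ - fderiv ℝ (fderiv ℝ p) ρ₀ (ρ - ρ₀)‖ * ‖A y‖ :=
          (fderiv ℝ p ρ - fderiv ℝ (fderiv ℝ p) ρ₀ (ρ - ρ₀)).le_opNorm (A y)
      _ ≤ (l0 / (2 * a ^ 2) * ‖ρ - ρ₀‖) * ‖A y‖ := by gcongr
      _ ≤ (l0 / (2 * a ^ 2) * (a * ‖z‖)) * (a * ‖z‖) := by
        gcongr
        · rw [← hAz]; exact hAa z
        · rw [← hy]; exact hAa y
      _ = l0 / 2 * ‖z‖ ^ 2 := by field_simp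
  rw [_root_.sub_apply, e2] at e4
  have e5 : ‖z‖ ^ 2 ≤ ∑ k, (z.1 k ^ 2 + z.2 k ^ 2) := by
    rw [Finset.sum_add_distrib]
    have h1 := norm_sq_le_sum z.1
    have h2 := norm_sq_le_sum z.2
    have h3 : 0 ≤ ∑ k, z.1 k ^ 2 := Finset.sum_nonneg fun i _ => sq_nonneg _
    have h4 : 0 ≤ ∑ k, z.2 k ^ 2 := Finset.sum_nonneg fun i _ => sq_nonneg _
    rw [Prod.norm_def]
    rcases max_cases ‖z.1‖ ‖z.2‖ with h | h <;> rw [h.1] <;> linarith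
  have e6 : l0 * ∑ k, (z.1 k ^ 2 + z.2 k ^ 2) ≤ ∑ k, lam k * (z.1 k ^ 2 + z.2 k ^ 2) := by
    rw [Finset.mul_sum]
    refine Finset.sum_le_sum fun i _ => mul_le_mul_of_nonneg_right (hlam i) (by positivity)
  have e7 : ∑ i, z.1 i * z.2 i ≤ (∑ k, (z.1 k ^ 2 + z.2 k ^ 2)) / 2 := by
    rw [Finset.sum_div]
    refine Finset.sum_le_sum fun i _ => ?_
    nlinarith [sq_nonneg (z.1 i - z.2 i)]
  have e8 := (abs_le.1 e4).2
  have e9 := mul_le_mul_of_nonneg_left e7 hl0.le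
  have e10 := mul_le_mul_of_nonneg_left e5 hl0.le
  linarith

lemma hess_q (hF : Facts p E₀ q δ R C) (hp : ContDiff ℝ 2 p) {ρ₀ : (Fin n → ℝ) × (Fin n → ℝ)}
    (h0 : Hvf p ρ₀ = 0) (η : Fin n → ℝ) :
    fderiv ℝ (fderiv ℝ p) ρ₀ (0, η) (0, η) = 2 * q ρ₀.1 η := by
  have h1 := taylor_lim hp ρ₀ (Hvf_zero h0) (fun _ => ((0 : Fin n → ℝ), η)) (0, η)
    tendsto_const_nhds
  have h2 : Tendsto (fun t : ℝ => (p (ρ₀ + t • ((0 : Fin n → ℝ), η)) - p ρ₀) / t ^ 2)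
      (nhdsWithin 0 (Ioi 0)) (nhds (q ρ₀.1 η)) := by
    refine Tendsto.congr' ?_ tendsto_const_nhds
    filter_upwards [self_mem_nhdsWithin] with t ht
    have htp : 0 < t := ht
    have h3 := hF.expand ρ₀.1 ρ₀.2 (t • η)
    rw [Prod.mk.eta, Hvf_zero h0, hF.qhom] at h3
    have e : ρ₀ + t • ((0 : Fin n → ℝ), η) = (ρ₀.1, ρ₀.2 + t • η) := by
      ext <;> simp
    rw [e, h3]
    simp
    field_simp
  have := tendsto_nhds_unique h1 h2
  linarith

lemma hess_q_inj (hF : Facts p E₀ q δ R C) (hp : ContDiff ℝ 2 p)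
    {ρ₀ : (Fin n → ℝ) × (Fin n → ℝ)} (h0 : Hvf p ρ₀ = 0) (η : Fin n → ℝ)
    (h : fderiv ℝ (fderiv ℝ p) ρ₀ (0, η) (0, η) = 0) : η = 0 := by
  rw [hess_q hF hp h0] at h
  have h1 := hF.qlow ρ₀.1 η
  have h2 := hF.δpos
  by_contra hne
  have h3 := norm_pos_iff.2 hne
  have := mul_pos h2 (pow_pos h3 2)
  linarith

end SymAux

namespace SymAux
open Set Metric

variable {n : ℕ} {p : (Fin n → ℝ) × (Fin n → ℝ) → ℝ} {E₀ : ℝ}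
    {q : (Fin n → ℝ) → (Fin n → ℝ) → ℝ} {δ R C : ℝ}

lemma q_bound (hF : Facts p E₀ q δ R C) (x₀ : Fin n → ℝ) :
    ∃ Cq : ℝ, 0 ≤ Cq ∧ ∀ x d, dist x x₀ ≤ 1 → q x d ≤ Cq * ‖d‖ ^ 2 := by
  obtain ⟨M, hM⟩ := ((isCompact_closedBall x₀ 1).prod
    (isCompact_closedBall (0 : Fin n → ℝ) 1)).exists_bound_of_continuousOn hF.qcont.continuousOn
  refine ⟨|M|, abs_nonneg _, fun x d hx => ?_⟩
  by_cases hd : d = 0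
  · have := hF.qhom x 0 d
    simp only [hd, smul_zero, ne_eq, OfNat.ofNat_ne_zero, not_false_eq_true, zero_pow,
      zero_mul] at this
    rw [hd, this]; simp
  · have hd0 : 0 < ‖d‖ := norm_pos_iff.2 hd
    have h1 : d = ‖d‖ • (‖d‖⁻¹ • d) := by
      rw [smul_smul, mul_inv_cancel₀ hd0.ne', one_smul]
    have h2 := hM (x, ‖d‖⁻¹ • d) ⟨mem_closedBall.2 hx, by
      rw [mem_closedBall_zero_iff, norm_smul, norm_inv, norm_norm, inv_mul_cancel₀ hd0.ne']⟩
    have h3 : q x (‖d‖⁻¹ • d) ≤ |M| := (le_abs_self _).trans (h2.trans (le_abs_self M))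
    rw [h1, hF.qhom, ← h1]
    nlinarith [pow_pos hd0 2]

set_option maxHeartbeats 2000000 in
lemma exists_section (hF : Facts p E₀ q δ R C) (hp : ContDiff ℝ 2 p)
    {ρ₀ : (Fin n → ℝ) × (Fin n → ℝ)} (h0 : Hvf p ρ₀ = 0) (hE : p ρ₀ = E₀)
    (A : ((Fin n → ℝ) × (Fin n → ℝ)) ≃L[ℝ] ((Fin n → ℝ) × (Fin n → ℝ))) (lam : Fin n → ℝ)
    {l0 : ℝ} (hl0 : 0 < l0) (hlam : ∀ k, l0 ≤ lam k)
    (hB : ∀ u v, fderiv ℝ (fderiv ℝ p) ρ₀ (A u) (A v) =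
        ∑ k, lam k * (u.2 k * v.2 k - u.1 k * v.1 k)) :
    ∃ (sec : (Fin n → ℝ) → (Fin n → ℝ)) (r Cs : ℝ), 0 < r ∧
      ContinuousOn sec (ball ρ₀.1 r \ {ρ₀.1}) ∧
      ∀ x ∈ ball ρ₀.1 r \ {ρ₀.1}, p (x, sec x) = E₀ ∧ 0 < Qf A ρ₀ (x, sec x) ∧
        dist (sec x) ρ₀.2 ≤ Cs * dist x ρ₀.1 := by
  let B := fderiv ℝ (fderiv ℝ p) ρ₀
  let α : (Fin n → ℝ) →L[ℝ] ((Fin n → ℝ) × (Fin n → ℝ)) := A.toContinuousLinearMap.comp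
    ((ContinuousLinearMap.id ℝ (Fin n → ℝ)).prod (ContinuousLinearMap.id ℝ (Fin n → ℝ)))
  have hα : ∀ y, α y = A (y, y) := fun y => rfl
  let M := (ContinuousLinearMap.fst ℝ (Fin n → ℝ) (Fin n → ℝ)).comp α
  have hMα : ∀ y, M y = (α y).1 := fun y => rfl
  have hBα : ∀ y, B (α y) (α y) = 0 := by
    intro y
    rw [hα]; change fderiv ℝ (fderiv ℝ p) ρ₀ (A (y, y)) (A (y, y)) = 0
    rw [hB]; simp
  have hMinj : Function.Injective M.toLinearMap := by
    rw [injective_iff_map_eq_zero]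
    intro y hy
    have hy1 : (α y).1 = 0 := hy
    have h1 : α y = (0, (α y).2) := Prod.ext hy1 rfl
    have h2 := hBα y
    rw [h1] at h2
    have h3 := hess_q_inj hF hp h0 _ h2
    rw [h3] at h1
    have h4 : A (y, y) = 0 := h1
    have h5 : (y, y) = (0 : (Fin n → ℝ) × (Fin n → ℝ)) := by
      simpa using h4
    exact congrArg Prod.fst h5
  let Me := (LinearEquiv.ofInjectiveEndo M.toLinearMap hMinj).toContinuousLinearEquiv
  have hMe : ∀ y, Me y = (α y).1 := fun y => rfl
  let G : (Fin n → ℝ) →L[ℝ] ((Fin n → ℝ) × (Fin n → ℝ)) := A.symm.toContinuousLinearMap.comp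
    (ContinuousLinearMap.inr ℝ (Fin n → ℝ) (Fin n → ℝ))
  have hG : ∀ d, A (G d) = (0, d) := fun d => A.apply_symm_apply _
  let N := (ContinuousLinearMap.snd ℝ (Fin n → ℝ) (Fin n → ℝ)).comp G -
    (ContinuousLinearMap.fst ℝ (Fin n → ℝ) (Fin n → ℝ)).comp G
  have hNinj : Function.Injective N.toLinearMap := by
    rw [injective_iff_map_eq_zero]
    intro d hd
    have hd1 : (G d).2 - (G d).1 = 0 := hd
    rw [sub_eq_zero] at hd1
    refine hess_q_inj hF hp h0 d ?_
    rw [← hG, hB, hd1]; simp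
  let Ne := (LinearEquiv.ofInjectiveEndo N.toLinearMap hNinj).toContinuousLinearEquiv
  have hNe : ∀ d, Ne d = (G d).2 - (G d).1 := fun d => rfl
  let β : (Fin n → ℝ) →L[ℝ] (Fin n → ℝ) := Ne.symm.toContinuousLinearMap
  have hβ : ∀ y, (G (β y)).2 - (G (β y)).1 = y := fun y => by
    rw [← hNe]; exact Ne.apply_symm_apply y
  let g := G.comp β
  have hAg : ∀ y, A.symm (0, β y) = g y := fun y => rfl
  have hBαβ : ∀ y, B (α y) (0, β y) = ∑ k, lam k * y k ^ 2 := by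
    intro y
    rw [← hG, hα]
    change fderiv ℝ (fderiv ℝ p) ρ₀ (A (y, y)) (A (G (β y))) = _
    rw [hB]
    refine Finset.sum_congr rfl fun k _ => ?_
    have := congrFun (hβ y) k
    simp only [Pi.sub_apply] at this
    simp only
    rw [← mul_sub, this]; ring
  let Y : (Fin n → ℝ) →L[ℝ] (Fin n → ℝ) := Me.symm.toContinuousLinearMap
  have hY : ∀ u, (α (Y u)).1 = u := fun u => by
    rw [← hMe]; exact Me.apply_symm_apply u
  have hYinj : ∀ u, Y u = 0 → u = 0 := fun u hu => by
    have := hY u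
    rw [hu, map_zero] at this
    exact this.symm
  obtain ⟨Cq, hCq0, hCq⟩ := q_bound hF ρ₀.1
  let K := 1 + ‖α‖ + ‖β‖ + ‖g‖ + ‖Y‖
  have hK1 : 1 ≤ K := by
    have := norm_nonneg α; have := norm_nonneg β; have := norm_nonneg g; have := norm_nonneg Y
    simp only [K]; linarith
  have hK0 : 0 < K := by linarith
  have hKα : ∀ y, ‖α y‖ ≤ K * ‖y‖ := fun y => (α.le_opNorm y).trans (by
    have := norm_nonneg α; have := norm_nonneg β; have := norm_nonneg g; have := norm_nonneg Y
    gcongr; simp only [K]; linarith)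
  have hKβ : ∀ y, ‖β y‖ ≤ K * ‖y‖ := fun y => (β.le_opNorm y).trans (by
    have := norm_nonneg α; have := norm_nonneg β; have := norm_nonneg g; have := norm_nonneg Y
    gcongr; simp only [K]; linarith)
  have hKg : ∀ y, ‖g y‖ ≤ K * ‖y‖ := fun y => (g.le_opNorm y).trans (by
    have := norm_nonneg α; have := norm_nonneg β; have := norm_nonneg g; have := norm_nonneg Y
    gcongr; simp only [K]; linarith)
  have hKY : ∀ y, ‖Y y‖ ≤ K * ‖y‖ := fun y => (Y.le_opNorm y).trans (by
    have := norm_nonneg α; have := norm_nonneg β; have := norm_nonneg g; have := norm_nonneg Y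
    gcongr; simp only [K]; linarith)
  obtain ⟨e, he0, he1, he2, he3⟩ : ∃ e : ℝ, 0 < e ∧ 16 * (Cq * K ^ 2) * e < l0 ^ 2 ∧ 4 * e < l0 ∧
      4 * (n * (2 * K + K ^ 2)) * e < l0 := by
    have h1 : ∀ᶠ e : ℝ in nhdsWithin 0 (Ioi 0), 16 * (Cq * K ^ 2) * e < l0 ^ 2 ∧ 4 * e < l0 ∧
        4 * (n * (2 * K + K ^ 2)) * e < l0 := by
      have hlin : ∀ a b : ℝ, 0 < b → ∀ᶠ e : ℝ in nhds 0, a * e < b := by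
        intro a b hb
        have : Continuous fun r : ℝ => a * r := by fun_prop
        exact (this.tendsto 0).eventually_lt_const (by simpa using hb)
      exact mem_nhdsWithin_of_mem_nhds ((hlin _ _ (by positivity)).and
        ((hlin _ _ hl0).and (hlin _ _ hl0)))
    obtain ⟨r, h, h'⟩ := (h1.and self_mem_nhdsWithin).exists
    exact ⟨r, h', h⟩
  obtain ⟨rT, hrT, hT1⟩ := taylor_one hp ρ₀ (Hvf_zero h0) (ε := e / K ^ 2) (by positivity)
  have hT2 := taylor_two hp ρ₀ (ε := e / K ^ 2) (by positivity) hT1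
  let P0 : (Fin n → ℝ) → ℝ := fun x => p (ρ₀ + α (Y (x - ρ₀.1))) - E₀
  let P1 : (Fin n → ℝ) → ℝ := fun x =>
    fderiv ℝ p (ρ₀ + α (Y (x - ρ₀.1))) (0, β (Y (x - ρ₀.1)))
  let P2 : (Fin n → ℝ) → ℝ := fun x => q x (β (Y (x - ρ₀.1)))
  let s : (Fin n → ℝ) → ℝ := fun x =>
    -2 * P0 x / (P1 x + Real.sqrt (P1 x ^ 2 - 4 * P2 x * P0 x))
  let sec : (Fin n → ℝ) → (Fin n → ℝ) := fun x =>
    ρ₀.2 + (α (Y (x - ρ₀.1))).2 + s x • β (Y (x - ρ₀.1))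
  have hsq : ∀ y : Fin n → ℝ, l0 * ‖y‖ ^ 2 ≤ ∑ k, lam k * y k ^ 2 := by
    intro y
    calc l0 * ‖y‖ ^ 2 ≤ l0 * ∑ k, y k ^ 2 := by gcongr; exact norm_sq_le_sum y
      _ = ∑ k, l0 * y k ^ 2 := Finset.mul_sum _ _ _
      _ ≤ _ := Finset.sum_le_sum fun k _ => mul_le_mul_of_nonneg_right (hlam k) (sq_nonneg _)
  have key : ∀ x ∈ ball ρ₀.1 (min 1 (rT / K ^ 2)) \ {ρ₀.1}, 0 < ‖Y (x - ρ₀.1)‖ ∧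
      |P0 x| ≤ e * ‖Y (x - ρ₀.1)‖ ^ 2 ∧ l0 / 2 * ‖Y (x - ρ₀.1)‖ ^ 2 ≤ P1 x ∧ 0 ≤ P2 x ∧
      P2 x ≤ Cq * K ^ 2 * ‖Y (x - ρ₀.1)‖ ^ 2 := by
    intro x hx
    have hxne : x - ρ₀.1 ≠ 0 := sub_ne_zero.2 hx.2
    have hxb := mem_ball.1 hx.1
    have hx1 : dist x ρ₀.1 ≤ 1 := hxb.le.trans (min_le_left _ _)
    have hx2 : ‖x - ρ₀.1‖ ≤ rT / K ^ 2 := by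
      rw [← dist_eq_norm]; exact hxb.le.trans (min_le_right _ _)
    simp only [P0, P1, P2]
    have hYb := hKY (x - ρ₀.1)
    have hy0 : 0 < ‖Y (x - ρ₀.1)‖ := norm_pos_iff.2 fun h => hxne (hYinj _ h)
    generalize Y (x - ρ₀.1) = y at *
    have hαr : ‖α y‖ ≤ rT := by
      calc ‖α y‖ ≤ K * ‖y‖ := hKα y
        _ ≤ K * (K * (rT / K ^ 2)) := by gcongr; exact hYb.trans (by gcongr)
        _ = rT := by field_simp
    refine ⟨hy0, ?_, ?_, ?_, ?_⟩
    · have h1 := hT2 (α y) hαr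
      have h2 : fderiv ℝ (fderiv ℝ p) ρ₀ (α y) (α y) = 0 := hBα y
      rw [h2, hE, zero_div, sub_zero] at h1
      calc _ ≤ _ := h1
        _ ≤ e / K ^ 2 * (K * ‖y‖) ^ 2 := by gcongr; exact hKα y
        _ = e * ‖y‖ ^ 2 := by field_simp
    · have h1 := hT1 (α y) hαr
      have h2 : |(fderiv ℝ p (ρ₀ + α y) - fderiv ℝ (fderiv ℝ p) ρ₀ (α y)) (0, β y)| ≤
          e * ‖y‖ ^ 2 := by
        have hn : ‖((0 : Fin n → ℝ), β y)‖ = ‖β y‖ := by simp [Prod.norm_def]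
        calc |(fderiv ℝ p (ρ₀ + α y) - fderiv ℝ (fderiv ℝ p) ρ₀ (α y)) (0, β y)|
            ≤ ‖fderiv ℝ p (ρ₀ + α y) - fderiv ℝ (fderiv ℝ p) ρ₀ (α y)‖ *
              ‖((0 : Fin n → ℝ), β y)‖ :=
              (fderiv ℝ p (ρ₀ + α y) - fderiv ℝ (fderiv ℝ p) ρ₀ (α y)).le_opNorm _
          _ ≤ (e / K ^ 2 * ‖α y‖) * ‖β y‖ := by rw [hn]; gcongr
          _ ≤ (e / K ^ 2 * (K * ‖y‖)) * (K * ‖y‖) := by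
            gcongr
            · exact hKα y
            · exact hKβ y
          _ = e * ‖y‖ ^ 2 := by field_simp
      have h3 : fderiv ℝ (fderiv ℝ p) ρ₀ (α y) (0, β y) = ∑ k, lam k * y k ^ 2 := hBαβ y
      rw [_root_.sub_apply, h3] at h2
      have h4 := (abs_le.1 h2).1
      have h5 := hsq y
      have h6 : e * ‖y‖ ^ 2 ≤ l0 / 2 * ‖y‖ ^ 2 := by gcongr; linarith
      linarith
    · have := hF.qlow x (β y)
      have := hF.δpos
      have : 0 ≤ δ * ‖β y‖ ^ 2 := by positivity
      linarith
    · calc _ ≤ Cq * ‖β y‖ ^ 2 := hCq x _ hx1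
        _ ≤ Cq * (K * ‖y‖) ^ 2 := by gcongr; exact hKβ y
        _ = _ := by ring
  have key2 : ∀ x ∈ ball ρ₀.1 (min 1 (rT / K ^ 2)) \ {ρ₀.1}, 0 < P1 x ∧
      P0 x + P1 x * s x + P2 x * s x ^ 2 = 0 ∧ |s x| ≤ 4 * e / l0 := by
    intro x hx
    obtain ⟨hy0, k0, k1, k2, k3⟩ := key x hx
    simp only [s]
    generalize ‖Y (x - ρ₀.1)‖ = y at *
    generalize P0 x = P0 at *
    generalize P1 x = P1 at *
    generalize P2 x = P2 at *
    have hy2 : 0 < y ^ 2 := by positivity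
    have hP1 : 0 < P1 := lt_of_lt_of_le (by positivity) k1
    have hD : 0 ≤ P1 ^ 2 - 4 * P2 * P0 := by
      have a1 : (l0 / 2 * y ^ 2) ^ 2 ≤ P1 ^ 2 := by gcongr
      have a2 : P2 * P0 ≤ (Cq * K ^ 2 * y ^ 2) * (e * y ^ 2) := by
        calc P2 * P0 ≤ P2 * |P0| := by gcongr; exact le_abs_self _
          _ ≤ _ := by gcongr
      have a3 : 16 * (Cq * K ^ 2) * e * (y ^ 2) ^ 2 ≤ l0 ^ 2 * (y ^ 2) ^ 2 := by gcongr
      nlinarith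
    obtain ⟨r1, r2⟩ := quad_root P0 P1 P2 hP1 hD
    refine ⟨hP1, r1, r2.trans ?_⟩
    rw [div_le_div_iff₀ hP1 hl0]
    have b1 : 2 * |P0| * l0 ≤ 2 * (e * y ^ 2) * l0 := by gcongr
    have b2 : 4 * e * (l0 / 2 * y ^ 2) ≤ 4 * e * P1 := by gcongr
    linarith
  have hσ1 : 4 * e / l0 ≤ 1 := by rw [div_le_one hl0]; exact he2.le
  refine ⟨sec, min 1 (rT / K ^ 2), (K + K) * K, by positivity, ?_, ?_⟩
  · have cY : Continuous fun x : Fin n → ℝ => Y (x - ρ₀.1) := by fun_prop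
    have cα : Continuous fun x : Fin n → ℝ => α (Y (x - ρ₀.1)) := α.continuous.comp cY
    have cβ : Continuous fun x : Fin n → ℝ => β (Y (x - ρ₀.1)) := β.continuous.comp cY
    have cP0 : Continuous P0 :=
      (hp.continuous.comp (continuous_const.add cα)).sub continuous_const
    have cP1 : Continuous P1 := by
      have h1 : Continuous (fderiv ℝ p) := hp.continuous_fderiv (by simp)
      exact (h1.comp (continuous_const.add cα)).clm_apply (continuous_const.prodMk cβ)
    have cP2 : Continuous P2 := hF.qcont.comp (continuous_id.prodMk cβ)
    have cs : ContinuousOn s (ball ρ₀.1 (min 1 (rT / K ^ 2)) \ {ρ₀.1}) := by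
      refine ContinuousOn.div (by fun_prop) (by fun_prop) ?_
      intro x hx
      have h1 := (key2 x hx).1
      have h2 := Real.sqrt_nonneg (P1 x ^ 2 - 4 * P2 x * P0 x)
      exact (by linarith : 0 < P1 x + Real.sqrt (P1 x ^ 2 - 4 * P2 x * P0 x)).ne'
    exact ((continuous_const.add cα.snd).continuousOn).add (cs.smul cβ.continuousOn)
  · intro x hx
    obtain ⟨hy0, -, -, -, -⟩ := key x hx
    obtain ⟨-, hroot, hs⟩ := key2 x hx
    have hYb := hKY (x - ρ₀.1)
    have hbase : ρ₀ + α (Y (x - ρ₀.1)) = (x, ρ₀.2 + (α (Y (x - ρ₀.1))).2) := by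
      refine Prod.ext ?_ rfl
      simp [hY]
    refine ⟨?_, ?_, ?_⟩
    · have h1 := hF.expand x (ρ₀.2 + (α (Y (x - ρ₀.1))).2) (s x • β (Y (x - ρ₀.1)))
      have h2 : ((0 : Fin n → ℝ), s x • β (Y (x - ρ₀.1))) =
          s x • ((0 : Fin n → ℝ), β (Y (x - ρ₀.1))) := by
        ext <;> simp
      rw [hF.qhom, ← hbase, h2, map_smul, smul_eq_mul] at h1
      change p (x, ρ₀.2 + (α (Y (x - ρ₀.1))).2 + s x • β (Y (x - ρ₀.1))) = E₀
      rw [h1]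
      simp only [P0, P1, P2] at hroot
      linarith
    · have h1 : (x, sec x) - ρ₀ = α (Y (x - ρ₀.1)) + s x • ((0 : Fin n → ℝ), β (Y (x - ρ₀.1))) := by
        refine Prod.ext ?_ ?_
        · simp [hY]
        · simp [sec]; abel
      have h2 : A.symm ((x, sec x) - ρ₀) =
          (Y (x - ρ₀.1), Y (x - ρ₀.1)) + s x • g (Y (x - ρ₀.1)) := by
        rw [h1, map_add, map_smul, hα, A.symm_apply_apply, hAg]
      rw [Qf, h2]
      have hgy := hKg (Y (x - ρ₀.1))
      generalize Y (x - ρ₀.1) = y at *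
      generalize s x = σ at *
      have hg1 : ‖(g y).1‖ ≤ K * ‖y‖ := (norm_fst_le _).trans hgy
      have hg2 : ‖(g y).2‖ ≤ K * ‖y‖ := (norm_snd_le _).trans hgy
      have e1 : ∑ i, ((y, y) + σ • g y).1 i * ((y, y) + σ • g y).2 i =
          ∑ i, y i ^ 2 + σ * ∑ i, y i * (g y).1 i + σ * ∑ i, y i * (g y).2 i +
          σ ^ 2 * ∑ i, (g y).1 i * (g y).2 i := by
        simp only [Finset.mul_sum, ← Finset.sum_add_distrib]
        refine Finset.sum_congr rfl fun i _ => ?_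
        simp; ring
      rw [e1]
      have b0 := norm_sq_le_sum y
      have b1 : |∑ i, y i * (g y).1 i| ≤ n * K * ‖y‖ ^ 2 := by
        calc _ ≤ n * (‖y‖ * ‖(g y).1‖) := abs_dot_le _ _
          _ ≤ n * (‖y‖ * (K * ‖y‖)) := by gcongr
          _ = _ := by ring
      have b2 : |∑ i, y i * (g y).2 i| ≤ n * K * ‖y‖ ^ 2 := by
        calc _ ≤ n * (‖y‖ * ‖(g y).2‖) := abs_dot_le _ _
          _ ≤ n * (‖y‖ * (K * ‖y‖)) := by gcongr
          _ = _ := by ring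
      have b3 : |∑ i, (g y).1 i * (g y).2 i| ≤ n * K ^ 2 * ‖y‖ ^ 2 := by
        calc _ ≤ n * (‖(g y).1‖ * ‖(g y).2‖) := abs_dot_le _ _
          _ ≤ n * ((K * ‖y‖) * (K * ‖y‖)) := by gcongr
          _ = _ := by ring
      have c1 : |σ * ∑ i, y i * (g y).1 i| ≤ |σ| * (n * K * ‖y‖ ^ 2) := by
        rw [abs_mul]; gcongr
      have c2 : |σ * ∑ i, y i * (g y).2 i| ≤ |σ| * (n * K * ‖y‖ ^ 2) := by
        rw [abs_mul]; gcongr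
      have c3 : |σ ^ 2 * ∑ i, (g y).1 i * (g y).2 i| ≤ |σ| * (n * K ^ 2 * ‖y‖ ^ 2) := by
        rw [abs_mul]
        have : |σ ^ 2| ≤ |σ| := by
          rw [abs_pow, sq]
          exact mul_le_of_le_one_left (abs_nonneg _) (hs.trans hσ1)
        gcongr
      have d1 := (abs_le.1 c1).1
      have d2 := (abs_le.1 c2).1
      have d3 := (abs_le.1 c3).1
      have f1 : |σ| * (n * (2 * K + K ^ 2)) < 1 := by
        calc |σ| * (n * (2 * K + K ^ 2)) ≤ 4 * e / l0 * (n * (2 * K + K ^ 2)) := by gcongr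
          _ = (4 * (n * (2 * K + K ^ 2)) * e) / l0 := by ring
          _ < 1 := by rw [div_lt_one hl0]; exact he3
      have f2 := mul_lt_mul_of_pos_right f1 (pow_pos hy0 2)
      linarith
    · have h1 : sec x - ρ₀.2 = (α (Y (x - ρ₀.1))).2 + s x • β (Y (x - ρ₀.1)) := by
        simp only [sec]; abel
      rw [dist_eq_norm, dist_eq_norm, h1]
      have a1 : ‖(α (Y (x - ρ₀.1))).2‖ ≤ K * ‖Y (x - ρ₀.1)‖ := (norm_snd_le _).trans (hKα _)
      have a2 : ‖s x • β (Y (x - ρ₀.1))‖ ≤ K * ‖Y (x - ρ₀.1)‖ := by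
        rw [norm_smul, Real.norm_eq_abs]
        exact (mul_le_of_le_one_left (norm_nonneg _) (hs.trans hσ1)).trans (hKβ _)
      calc _ ≤ K * ‖Y (x - ρ₀.1)‖ + K * ‖Y (x - ρ₀.1)‖ := (norm_add_le _ _).trans (add_le_add a1 a2)
        _ = (K + K) * ‖Y (x - ρ₀.1)‖ := by ring
        _ ≤ (K + K) * (K * ‖x - ρ₀.1‖) := by gcongr
        _ = _ := by ring

end SymAux

/-- There is no Schrödinger-type symbol `p` and energy `E₀ > 0` whose trapped set `K(E₀)`
equals `{ρ₁, ρ₂} ∪ 𝓗`, with `ρ₁ ≠ ρ₂` hyperbolic fixed points of `H_p` at energy `E₀` and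
`𝓗` the union of the heteroclinic trajectories from `ρ₁` to `ρ₂`. -/
theorem stmt_1 {n : ℕ} (hn : 1 ≤ n) :
    ¬ ∃ (p : (Fin n → ℝ) × (Fin n → ℝ) → ℝ) (E₀ : ℝ)
        (ρ₁ ρ₂ : (Fin n → ℝ) × (Fin n → ℝ)),
      IsSchrodingerSymbol p ∧ 0 < E₀ ∧ ρ₁ ≠ ρ₂ ∧
      IsHyperbolicFixedPt p E₀ ρ₁ ∧ IsHyperbolicFixedPt p E₀ ρ₂ ∧
      trappedSet p E₀ = {ρ₁, ρ₂} ∪ heteroclinicSet p ρ₁ ρ₂ := by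
  rintro ⟨p, E₀, ρ₁, ρ₂, hS, hE0, hne, hh1, hh2, htr⟩
  obtain ⟨q, δ, R, C, hF⟩ := SymAux.exists_facts hS E₀
  have hp : ContDiff ℝ 2 p := hF.smooth.of_le (WithTop.coe_le_coe.2 (le_top : (2 : ℕ∞) ≤ ⊤))
  obtain ⟨A, lam, hlam, hA, hB⟩ := SymAux.linear_form hp hh2
  have : Nonempty (Fin n) := ⟨⟨0, hn⟩⟩
  obtain ⟨k0, hk0⟩ := Finite.exists_min lam
  obtain ⟨r₁, hr₁, hQ⟩ := SymAux.Qf_growth hp hh2.1 A lam (hlam k0) hk0 hA hB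
  obtain ⟨sec, r₂, Cs, hr₂, hsc, hsec⟩ :=
    SymAux.exists_section hF hp hh2.1 hh2.2.1 A lam (hlam k0) hk0 hB
  have hsub : Metric.ball ρ₂.1 (min r₁ r₂) \ {ρ₂.1} ⊆ Metric.ball ρ₂.1 r₂ \ {ρ₂.1} :=
    Set.sdiff_subset_sdiff_left (Metric.ball_subset_ball (min_le_right _ _))
  exact SymAux.main_contra hn hF hE0 hne hh1.1 hh1.2.1 hh2.1 hh2.2.1 (r₁ := min r₁ r₂)
    (lt_min hr₁ hr₂) (hlam k0) (SymAux.Qf_hasFDerivAt A ρ₂ ρ₂).1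
    (fun ρ h => hQ ρ (h.trans (min_le_left _ _))) sec (hsc.mono hsub)
    (fun x hx => hsec x (hsub hx)) htr
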